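/- Assume either (a) d ≠ 0 and (s,ε) ∈ S[d] is not a minimal element of S[d], or (b) d = 0 and (s,ε) ∈ S is not a minimal element of S (in case (b) all sets and spans below are taken within S and the decoration [d] is dropped). Let Z be the set of elements (s'',ε'') of S[d] immediately below (s,ε) (i.e., (s'',ε'') < (s,ε) with no element strictly between), fix (s',ε') ∈ Z, and set K = Y_<(s',ε')[d] + Σ_{(s'',ε'') ∈ Z, (s'',ε'') ≠ (s',ε')} Y(s'',ε'')[d]. Then there exists no Sp(V)-stable k-subspace W of Y(s,ε)[d] with K ⊆ W, W + Y(s',ε')[d] = Y(s,ε)[d], and W ∩ (Y(s',ε')[d] + K) ⊆ K; equivalently, the short exact sequence of kSp(V)-modules 0 → (Y(s',ε')[d]+K)/K → Y(s,ε)[d]/K → Y(s,ε)[d]/Y_<(s,ε)[d] → 0 does not split. -/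

import Mathlib

open scoped Classical

noncomputable section

/-- The `2m`-dimensional standard symplectic space over `k = F_q = GaloisField p t`:
pairs `(x,y)` of `m`-tuples; the coordinates are `x_i(v) = v.1 i`, `y_i(v) = v.2 i`. -/
abbrev SympV (p t m : ℕ) [Fact p.Prime] : Type :=
  (Fin m → GaloisField p t) × (Fin m → GaloisField p t)

/-- The nonsingular alternating bilinear form
`⟨(x,y),(x',y')⟩ = Σ_i (x_i y'_i − y_i x'_i)`. -/
def sform {p t m : ℕ} [Fact p.Prime] (v w : SympV p t m) : GaloisField p t :=
  ∑ i, (v.1 i * w.2 i - v.2 i * w.1 i)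

/-- Membership in the symplectic group `Sp(V)`: a linear automorphism of `V`
preserving the form. -/
def IsSymp {p t m : ℕ} [Fact p.Prime]
    (g : SympV p t m ≃ₗ[GaloisField p t] SympV p t m) : Prop :=
  ∀ v w, sform (g v) (g w) = sform v w

/-- A `k`-subspace `M` of `k[V]` is `Sp(V)`-stable (a `kSp(V)`-submodule) if it is
closed under the action `(g·f)(v) = f(g⁻¹v)`. -/
def SpStable {p t m : ℕ} [Fact p.Prime]
    (M : Submodule (GaloisField p t) (SympV p t m → GaloisField p t)) : Prop :=
  ∀ g : SympV p t m ≃ₗ[GaloisField p t] SympV p t m, IsSymp g →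
    ∀ h ∈ M, (fun v => h (g.symm v)) ∈ M

/-- The monomial `x^α y^β = ∏_i x_i^{α_i} y_i^{β_i}` as a function `V → k`. -/
def mono {p t m : ℕ} [Fact p.Prime] (α β : Fin m → ℕ) :
    SympV p t m → GaloisField p t :=
  fun v => ∏ i, (v.1 i ^ α i * v.2 i ^ β i)

/-- The complementary multi-index `ᾱ = (p−1−α₁,…,p−1−α_m)`. -/
def abar (p : ℕ) {m : ℕ} (α : Fin m → ℕ) : Fin m → ℕ := fun i => p - 1 - α i

/-- `α! = ∏_i α_i!`, computed in the prime field `F_p ⊆ k`. -/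
def factk (p t : ℕ) [Fact p.Prime] {m : ℕ} (α : Fin m → ℕ) : GaloisField p t :=
  ∏ i, ((α i).factorial : GaloisField p t)

/-- Allowable `j`-th digit of a symplectic basis function, of degree `lam`;
`pl` records whether this digit counts towards the signature (a monomial
`x^α y^{ᾱ}` or a '+' binomial when `lam = m(p−1)`). -/
def IsDigit (p t m lam : ℕ) [Fact p.Prime] (pl : Prop)
    (g : SympV p t m → GaloisField p t) : Prop :=
  (lam ≠ m * (p - 1) ∧ ¬pl ∧
    ∃ α β : Fin m → ℕ, (∀ i, α i ≤ p - 1) ∧ (∀ i, β i ≤ p - 1) ∧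
      (∑ i, α i) + (∑ i, β i) = lam ∧ g = mono α β) ∨
  (lam = m * (p - 1) ∧ pl ∧
    ∃ α : Fin m → ℕ, (∀ i, α i ≤ p - 1) ∧ g = mono α (abar p α)) ∨
  (lam = m * (p - 1) ∧
    ∃ α β : Fin m → ℕ, (∀ i, α i ≤ p - 1) ∧ (∀ i, β i ≤ p - 1) ∧
      (∑ i, α i) + (∑ i, β i) = m * (p - 1) ∧ β ≠ abar p α ∧
      g = mono α β +
        ((if pl then (1 : GaloisField p t) else -1) *
          ((-1) ^ ((∑ i, β i) + m) * factk p t α * factk p t β)) •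
            mono (abar p β) (abar p α))

/-- `f` is a symplectic basis function of type `λ` with signature `ε`:
`f = f₀·f₁^p⋯f_{t−1}^{p^{t−1}}` with every digit `f_j` allowable of degree `λ_j`,
and `ε` is the set of digits of '+' kind. -/
def IsSBF (p t m : ℕ) [Fact p.Prime] (lam : Fin t → ℕ) (eps : Finset (Fin t))
    (f : SympV p t m → GaloisField p t) : Prop :=
  ∃ g : Fin t → (SympV p t m → GaloisField p t),
    (∀ j, IsDigit p t m (lam j) (j ∈ eps) (g j)) ∧
    f = fun v => ∏ j, (g j v) ^ (p ^ (j : ℕ))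

/-- The `j`-th `p`-adic digit of `d`. -/
def digitp (p d j : ℕ) : ℕ := d / p ^ j % p

/-- The type `λ` attached to a tuple `s` (for `d`): `λ_j = p·s_{j+1} − s_j + d_j`,
indices mod `t`. -/
def lamOf (p t d : ℕ) [NeZero t] (s : Fin t → ℤ) (j : Fin t) : ℤ :=
  (p : ℤ) * s (j + 1) - s j + digitp p d (j : ℕ)

/-- The type of `s` as a tuple of naturals. -/
def lamOfN (p t d : ℕ) [NeZero t] (s : Fin t → ℤ) (j : Fin t) : ℕ :=
  (lamOf p t d s j).toNat

/-- Membership in `H[d]`: `0 ≤ s_j ≤ 2m−1` and `0 ≤ λ_j ≤ 2m(p−1)` for all `j`. -/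
def memHd (p t m d : ℕ) [NeZero t] (s : Fin t → ℤ) : Prop :=
  (∀ j, 0 ≤ s j ∧ s j ≤ 2 * m - 1) ∧
  (∀ j, 0 ≤ lamOf p t d s j ∧ lamOf p t d s j ≤ 2 * m * ((p : ℤ) - 1))

/-- Membership in `H`: `1 ≤ s_j ≤ 2m−1` and `0 ≤ p·s_{j+1} − s_j ≤ 2m(p−1)`. -/
def memH (p t m : ℕ) [NeZero t] (s : Fin t → ℤ) : Prop :=
  (∀ j, 1 ≤ s j ∧ s j ≤ 2 * m - 1) ∧
  (∀ j, 0 ≤ lamOf p t 0 s j ∧ lamOf p t 0 s j ≤ 2 * m * ((p : ℤ) - 1))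

/-- `J(s) = {j : λ_j = m(p−1)}`. -/
def Jset (p t m d : ℕ) [NeZero t] (s : Fin t → ℤ) : Finset (Fin t) :=
  Finset.univ.filter (fun j => lamOf p t d s j = m * ((p : ℤ) - 1))

/-- Membership in `S[d]`: `s ∈ H[d]` and `ε ⊆ J(s)`. -/
def memSd (p t m d : ℕ) [NeZero t] (s : Fin t → ℤ) (eps : Finset (Fin t)) : Prop :=
  memHd p t m d s ∧ eps ⊆ Jset p t m d s

/-- Membership in `S`: `s ∈ H` and `ε ⊆ J(s)` (with `d = 0`). -/
def memS (p t m : ℕ) [NeZero t] (s : Fin t → ℤ) (eps : Finset (Fin t)) : Prop :=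
  memH p t m s ∧ eps ⊆ Jset p t m 0 s

/-- Case distinction: for `d ≠ 0` the relevant poset is `S[d]`, for `d = 0` it is `S`. -/
def memCase (p t m d : ℕ) [NeZero t] (s : Fin t → ℤ) (eps : Finset (Fin t)) : Prop :=
  if d = 0 then memS p t m s eps else memSd p t m d s eps

/-- `Z(s',s) = {j : s'_j = s_j, s'_{j+1} = s_{j+1}, λ'_j = m(p−1)}`. -/
def Zset (p t m d : ℕ) [NeZero t] (s' s : Fin t → ℤ) : Finset (Fin t) :=
  Finset.univ.filter (fun j =>
    s' j = s j ∧ s' (j + 1) = s (j + 1) ∧ lamOf p t d s' j = m * ((p : ℤ) - 1))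

/-- The order on `S[d]` (and on `S`): `(s',ε') ≤ (s,ε)` iff `s' ≤ s` pointwise and
`ε ∩ Z(s',s) = ε' ∩ Z(s',s)`. -/
def leSd (p t m d : ℕ) [NeZero t] (s' : Fin t → ℤ) (eps' : Finset (Fin t))
    (s : Fin t → ℤ) (eps : Finset (Fin t)) : Prop :=
  (∀ j, s' j ≤ s j) ∧ eps ∩ Zset p t m d s' s = eps' ∩ Zset p t m d s' s

/-- `Y(s,ε)[d]` (for `d ≠ 0`), resp. `Y(s,ε)` (for `d = 0`): the span in `k[V]` of all
symplectic basis functions with signed `H`-type `(s',ε') ≤ (s,ε)` in `S[d]`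
(resp. in `S`). -/
def Ymod (p t m d : ℕ) [Fact p.Prime] [NeZero t] (s : Fin t → ℤ)
    (eps : Finset (Fin t)) :
    Submodule (GaloisField p t) (SympV p t m → GaloisField p t) :=
  Submodule.span (GaloisField p t)
    {f | ∃ s' eps', memCase p t m d s' eps' ∧ leSd p t m d s' eps' s eps ∧
      IsSBF p t m (lamOfN p t d s') eps' f}

/-- `Y_<(s,ε)[d]`: the span of the symplectic basis functions with signed `H`-type
strictly below `(s,ε)`. -/
def Yltmod (p t m d : ℕ) [Fact p.Prime] [NeZero t] (s : Fin t → ℤ)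
    (eps : Finset (Fin t)) :
    Submodule (GaloisField p t) (SympV p t m → GaloisField p t) :=
  Submodule.span (GaloisField p t)
    {f | ∃ s' eps', memCase p t m d s' eps' ∧ leSd p t m d s' eps' s eps ∧
      ¬(s' = s ∧ eps' = eps) ∧ IsSBF p t m (lamOfN p t d s') eps' f}

/-- Strict order on `S[d]` (resp. `S`), with membership of the smaller element. -/
def ltCase (p t m d : ℕ) [NeZero t] (s' : Fin t → ℤ) (eps' : Finset (Fin t))
    (s : Fin t → ℤ) (eps : Finset (Fin t)) : Prop :=
  memCase p t m d s' eps' ∧ leSd p t m d s' eps' s eps ∧ ¬(s' = s ∧ eps' = eps)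

/-- `(s',ε')` is immediately below `(s,ε)`: strictly below with nothing strictly
in between. -/
def ImmBelow (p t m d : ℕ) [NeZero t] (s' : Fin t → ℤ) (eps' : Finset (Fin t))
    (s : Fin t → ℤ) (eps : Finset (Fin t)) : Prop :=
  ltCase p t m d s' eps' s eps ∧
  ¬∃ (s'' : Fin t → ℤ) (eps'' : Finset (Fin t)),
      ltCase p t m d s'' eps'' s eps ∧ ltCase p t m d s' eps' s'' eps''

/-! ### Finite field sums and coefficient functionals -/

instance galFintype (p t : ℕ) [Fact p.Prime] : Fintype (GaloisField p t) := Fintype.ofFinite _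

lemma gal_card (p t : ℕ) [Fact p.Prime] (ht : t ≠ 0) :
    Fintype.card (GaloisField p t) = p ^ t := by
  rw [← Nat.card_eq_fintype_card, GaloisField.card p t ht]

lemma gal_pow (p t : ℕ) [Fact p.Prime] (ht : t ≠ 0) (x : GaloisField p t) : x ^ p ^ t = x := by
  rw [← gal_card p t ht]; exact FiniteField.pow_card x

/-- The weights dual to the powers `c ^ b`. -/
def wt (p t n : ℕ) [Fact p.Prime] (c : GaloisField p t) : GaloisField p t :=
  if n = 0 then (if c = 0 then 1 else 0) else -c ^ (p ^ t - 1 - n)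

lemma one_lt_q (p t : ℕ) [Fact p.Prime] (ht : t ≠ 0) : 1 < p ^ t :=
  Nat.one_lt_pow ht (Fact.out : p.Prime).one_lt

lemma gal_sum_pow (p t : ℕ) [Fact p.Prime] (ht : t ≠ 0) (n : ℕ) :
    ∑ c : GaloisField p t, c ^ n =
      if n ≠ 0 ∧ (p ^ t - 1) ∣ n then -1 else 0 := by
  have h1 := FiniteField.sum_pow_units (GaloisField p t) n
  rw [gal_card p t ht] at h1
  by_cases hn : n = 0
  · subst hn
    simp only [pow_zero, Finset.sum_const, Finset.card_univ, gal_card p t ht]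
    simp [CharP.cast_eq_zero, ht]
  · have h2 : ∑ c : GaloisField p t, c ^ n = ∑ x : (GaloisField p t)ˣ, (x : GaloisField p t) ^ n := by
      rw [← Finset.sum_subset (Finset.subset_univ (Finset.univ.image
        (fun x : (GaloisField p t)ˣ => (x : GaloisField p t))))]
      · rw [Finset.sum_image]
        intro x _ y _ h; exact Units.ext h
      · intro x _ hx
        by_cases h0 : x = 0
        · simp [h0, hn]
        · exact absurd (Finset.mem_image.2 ⟨Units.mk0 x h0, Finset.mem_univ _, rfl⟩) hx
    rw [h2, h1]; simp [hn]

lemma wt_sum (p t : ℕ) [Fact p.Prime] (ht : t ≠ 0) (n b : ℕ) (hn : n < p ^ t) (hb : b < p ^ t) :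
    ∑ c : GaloisField p t, wt p t n c * c ^ b = if n = b then 1 else 0 := by
  have hq := one_lt_q p t ht
  unfold wt
  by_cases h0 : n = 0
  · subst h0
    simp only [if_true, ite_mul, one_mul, zero_mul, Finset.sum_ite_eq', Finset.mem_univ]
    rcases Nat.eq_zero_or_pos b with rfl | hb0
    · simp
    · rw [zero_pow hb0.ne', if_neg hb0.ne]
  · simp only [if_neg h0, neg_mul, ← pow_add, Finset.sum_neg_distrib]
    rw [gal_sum_pow p t ht]
    have : (p ^ t - 1 - n + b ≠ 0 ∧ p ^ t - 1 ∣ p ^ t - 1 - n + b) ↔ n = b := by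
      constructor
      · rintro ⟨h1, k, hk⟩
        have hk1 : k < 2 := by
          by_contra hk2
          have : (p ^ t - 1) * 2 ≤ (p ^ t - 1) * k := Nat.mul_le_mul_left _ (by omega)
          omega
        have hk0 : k ≠ 0 := by rintro rfl; simp at hk; omega
        have : k = 1 := by omega
        subst this
        omega
      · rintro rfl
        have : p ^ t - 1 - n + n = p ^ t - 1 := by omega
        rw [this]; exact ⟨by omega, dvd_rfl⟩
    by_cases hnb : n = b
    · rw [if_pos (this.2 hnb), if_pos hnb, neg_neg]
    · rw [if_neg (fun h => hnb (this.1 h)), if_neg hnb, neg_zero]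

/-- The coefficient functional of the monomial `x^α y^β` on functions on `V`. -/
def coefF {p t m : ℕ} [Fact p.Prime] (α β : Fin m → ℕ) :
    (SympV p t m → GaloisField p t) →ₗ[GaloisField p t] GaloisField p t where
  toFun h := ∑ v : SympV p t m, (∏ i, (wt p t (α i) (v.1 i) * wt p t (β i) (v.2 i))) * h v
  map_add' f g := by simp [mul_add, Finset.sum_add_distrib]
  map_smul' c f := by
    simp only [Pi.smul_apply, smul_eq_mul, RingHom.id_apply, Finset.mul_sum]
    exact Finset.sum_congr rfl fun v _ => by ring

lemma coefF_mono {p t m : ℕ} [Fact p.Prime] (ht : t ≠ 0) (α β α' β' : Fin m → ℕ)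
    (hα : ∀ i, α i < p ^ t) (hβ : ∀ i, β i < p ^ t) (hα' : ∀ i, α' i < p ^ t)
    (hβ' : ∀ i, β' i < p ^ t) :
    coefF (p := p) (t := t) α β (mono α' β') = if α = α' ∧ β = β' then 1 else 0 := by
  have key : coefF (p := p) (t := t) α β (mono α' β') =
      (∏ i, ∑ c : GaloisField p t, wt p t (α i) c * c ^ α' i) *
      (∏ i, ∑ c : GaloisField p t, wt p t (β i) c * c ^ β' i) := by
    rw [Fintype.prod_sum, Fintype.prod_sum, Finset.sum_mul_sum, ← Fintype.sum_prod_type']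
    refine Finset.sum_congr rfl fun v _ => ?_
    simp only [mono, ← Finset.prod_mul_distrib]
    exact Finset.prod_congr rfl fun i _ => by ring
  rw [key]
  simp only [wt_sum p t ht _ _ (hα _) (hα' _), wt_sum p t ht _ _ (hβ _) (hβ' _)]
  by_cases h1 : α = α'
  · by_cases h2 : β = β'
    · simp [h1, h2]
    · obtain ⟨i, hi⟩ := Function.ne_iff.1 h2
      rw [if_neg (fun h => h2 h.2)]
      rw [Finset.prod_eq_zero (s := Finset.univ) (i := i)
        (f := fun i => if β i = β' i then (1 : GaloisField p t) else 0) (Finset.mem_univ i)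
        (if_neg hi), mul_zero]
  · obtain ⟨i, hi⟩ := Function.ne_iff.1 h1
    rw [if_neg (fun h => h1 h.1)]
    rw [Finset.prod_eq_zero (s := Finset.univ) (i := i)
        (f := fun i => if α i = α' i then (1 : GaloisField p t) else 0) (Finset.mem_univ i)
        (if_neg hi), zero_mul]

/-! ### Base `p` expansions -/

lemma base_inj {p t : ℕ} (a b : Fin t → ℕ) (ha : ∀ j, a j < p) (hb : ∀ j, b j < p)
    (h : ∑ j, a j * p ^ (j : ℕ) = ∑ j, b j * p ^ (j : ℕ)) : a = b := by
  have : (fun j => (⟨a j, ha j⟩ : Fin p)) = fun j => ⟨b j, hb j⟩ := by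
    apply finFunctionFinEquiv.injective
    apply Fin.ext
    rw [finFunctionFinEquiv_apply, finFunctionFinEquiv_apply]
    exact h
  funext j
  have := congrFun this j
  simpa using this

lemma base_lt {p t : ℕ} (a : Fin t → ℕ) (ha : ∀ j, a j < p) :
    ∑ j, a j * p ^ (j : ℕ) < p ^ t := by
  have := (finFunctionFinEquiv (fun j => (⟨a j, ha j⟩ : Fin p))).2
  rwa [finFunctionFinEquiv_apply] at this

lemma mono_prod {p t m : ℕ} [Fact p.Prime] (α β : Fin t → Fin m → ℕ) (v : SympV p t m) :
    ∏ j, (mono (α j) (β j) v) ^ p ^ (j : ℕ) =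
      mono (fun l => ∑ j, α j l * p ^ (j : ℕ)) (fun l => ∑ j, β j l * p ^ (j : ℕ)) v := by
  simp only [mono, ← Finset.prod_pow, mul_pow]
  rw [Finset.prod_comm]
  refine Finset.prod_congr rfl fun l _ => ?_
  rw [Finset.prod_mul_distrib, ← Finset.prod_pow_eq_pow_sum, ← Finset.prod_pow_eq_pow_sum]
  simp only [pow_mul]

/-- Coefficient functional of a product of twisted digits. -/
lemma coefF_digits {p t m : ℕ} [Fact p.Prime] (ht : t ≠ 0) (α β α' β' : Fin t → Fin m → ℕ)
    (hα : ∀ j i, α j i < p) (hβ : ∀ j i, β j i < p) (hα' : ∀ j i, α' j i < p)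
    (hβ' : ∀ j i, β' j i < p) :
    coefF (p := p) (t := t) (fun l => ∑ j, α j l * p ^ (j : ℕ)) (fun l => ∑ j, β j l * p ^ (j : ℕ))
      (fun v => ∏ j, (mono (α' j) (β' j) v) ^ p ^ (j : ℕ)) =
      ∏ j, (if α j = α' j ∧ β j = β' j then (1 : GaloisField p t) else 0) := by
  simp only [mono_prod]
  have : (fun v : SympV p t m => mono (fun l => ∑ j, α' j l * p ^ (j : ℕ))
      (fun l => ∑ j, β' j l * p ^ (j : ℕ)) v) = mono (fun l => ∑ j, α' j l * p ^ (j : ℕ))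
      (fun l => ∑ j, β' j l * p ^ (j : ℕ)) := rfl
  rw [this, coefF_mono ht _ _ _ _ (fun i => base_lt _ fun j => hα j i)
    (fun i => base_lt _ fun j => hβ j i) (fun i => base_lt _ fun j => hα' j i)
    (fun i => base_lt _ fun j => hβ' j i)]
  by_cases h : ∀ j, α j = α' j ∧ β j = β' j
  · rw [if_pos, Finset.prod_eq_one (fun j _ => if_pos (h j))]
    constructor <;> funext l <;> refine Finset.sum_congr rfl fun j _ => ?_
    · rw [(h j).1]
    · rw [(h j).2]
  · rw [if_neg]
    · push Not at h
      obtain ⟨j, hj⟩ := h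
      rw [Finset.prod_eq_zero (Finset.mem_univ j)]
      rw [if_neg]; tauto
    · rintro ⟨h1, h2⟩
      apply h
      intro j
      constructor
      · funext l
        have := base_inj (fun j => α j l) (fun j => α' j l) (fun j => hα j l) (fun j => hα' j l)
          (congrFun h1 l)
        exact congrFun this j
      · funext l
        have := base_inj (fun j => β j l) (fun j => β' j l) (fun j => hβ j l) (fun j => hβ' j l)
          (congrFun h2 l)
        exact congrFun this j


/-! ### Transvections and torus elements -/

/-- The map `x_z ↦ x_z + c y_z`. -/
def tv {p t m : ℕ} [Fact p.Prime] (z : Fin m) (c : GaloisField p t) (v : SympV p t m) :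
    SympV p t m :=
  (v.1 + Pi.single z (c * v.2 z), v.2)

/-- The map `x_z ↦ c x_z`, `y_z ↦ c⁻¹ y_z`. -/
def tor {p t m : ℕ} [Fact p.Prime] (z : Fin m) (c : (GaloisField p t)ˣ) (v : SympV p t m) :
    SympV p t m :=
  (fun i => (if i = z then (c : GaloisField p t) else 1) * v.1 i,
   fun i => (if i = z then ((c⁻¹ : (GaloisField p t)ˣ) : GaloisField p t) else 1) * v.2 i)

/-- `tv` as a linear automorphism. -/
def tvEquiv {p t m : ℕ} [Fact p.Prime] (z : Fin m) (c : GaloisField p t) :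
    SympV p t m ≃ₗ[GaloisField p t] SympV p t m where
  toFun := tv z (-c)
  invFun := tv z c
  map_add' v w := by
    refine Prod.ext ?_ rfl
    funext i
    by_cases h : i = z
    · subst h; simp [tv]; ring
    · simp [tv, h]
  map_smul' a v := by
    refine Prod.ext ?_ rfl
    funext i
    by_cases h : i = z
    · subst h; simp [tv]; ring
    · simp [tv, h]
  left_inv v := by
    refine Prod.ext ?_ rfl
    funext i
    by_cases h : i = z
    · subst h; simp [tv]
    · simp [tv, h]
  right_inv v := by
    refine Prod.ext ?_ rfl
    funext i
    by_cases h : i = z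
    · subst h; simp [tv]
    · simp [tv, h]

/-- `tor` as a linear automorphism. -/
def torEquiv {p t m : ℕ} [Fact p.Prime] (z : Fin m) (c : (GaloisField p t)ˣ) :
    SympV p t m ≃ₗ[GaloisField p t] SympV p t m where
  toFun := tor z c⁻¹
  invFun := tor z c
  map_add' v w := by
    refine Prod.ext ?_ ?_ <;> funext i <;> simp [tor, mul_add]
  map_smul' a v := by
    refine Prod.ext ?_ ?_ <;> funext i <;> simp [tor] <;> split_ifs <;> ring
  left_inv v := by
    refine Prod.ext ?_ ?_ <;> funext i <;> by_cases h : i = z <;> simp [tor, h]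
  right_inv v := by
    refine Prod.ext ?_ ?_ <;> funext i <;> by_cases h : i = z <;> simp [tor, h]

lemma tvEquiv_symp {p t m : ℕ} [Fact p.Prime] (z : Fin m) (c : GaloisField p t) :
    IsSymp (tvEquiv (m := m) z c) := by
  intro v w
  refine Finset.sum_congr rfl fun i _ => ?_
  change (tv z (-c) v).1 i * (tv z (-c) w).2 i - (tv z (-c) v).2 i * (tv z (-c) w).1 i = _
  by_cases h : i = z
  · subst h; simp [tv]; ring
  · simp [tv, h]

lemma torEquiv_symp {p t m : ℕ} [Fact p.Prime] (z : Fin m) (c : (GaloisField p t)ˣ) :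
    IsSymp (torEquiv (m := m) z c) := by
  intro v w
  refine Finset.sum_congr rfl fun i _ => ?_
  change (tor z c⁻¹ v).1 i * (tor z c⁻¹ w).2 i - (tor z c⁻¹ v).2 i * (tor z c⁻¹ w).1 i = _
  by_cases h : i = z
  · subst h
    have hc : (c : GaloisField p t) ≠ 0 := c.ne_zero
    simp [tor]; field_simp
  · simp [tor, h]

/-- The operator extracting the coefficient of `c ^ n` in `h(x_z + c y_z)`. -/
def Xop {p t m : ℕ} [Fact p.Prime] (z : Fin m) (n : ℕ) :
    (SympV p t m → GaloisField p t) →ₗ[GaloisField p t] (SympV p t m → GaloisField p t) where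
  toFun h := ∑ c : GaloisField p t, wt p t n c • (fun v => h (tv z c v))
  map_add' f g := by
    rw [← Finset.sum_add_distrib]
    exact Finset.sum_congr rfl fun c _ => by rw [← smul_add]; rfl
  map_smul' a f := by
    simp only [RingHom.id_apply, Finset.smul_sum]
    exact Finset.sum_congr rfl fun c _ => by rw [smul_comm]; rfl

lemma Xop_apply {p t m : ℕ} [Fact p.Prime] (z : Fin m) (n : ℕ)
    (h : SympV p t m → GaloisField p t) (v : SympV p t m) :
    Xop z n h v = ∑ c : GaloisField p t, wt p t n c * h (tv z c v) := by
  simp [Xop, Finset.sum_apply]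

/-- The projection onto a weight space of the torus. -/
def Eop {p t m : ℕ} [Fact p.Prime] (z : Fin m) (N : ℤ) :
    (SympV p t m → GaloisField p t) →ₗ[GaloisField p t] (SympV p t m → GaloisField p t) where
  toFun h := ∑ c : (GaloisField p t)ˣ,
    (-((c ^ (-N) : (GaloisField p t)ˣ) : GaloisField p t)) • (fun v => h (tor z c v))
  map_add' f g := by
    rw [← Finset.sum_add_distrib]
    exact Finset.sum_congr rfl fun c _ => by rw [← smul_add]; rfl
  map_smul' a f := by
    simp only [RingHom.id_apply, Finset.smul_sum]
    exact Finset.sum_congr rfl fun c _ => by rw [smul_comm]; rfl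

lemma Xop_stable {p t m : ℕ} [Fact p.Prime] (z : Fin m) (n : ℕ)
    {W : Submodule (GaloisField p t) (SympV p t m → GaloisField p t)} (hW : SpStable W)
    {h : SympV p t m → GaloisField p t} (hh : h ∈ W) : Xop z n h ∈ W :=
  W.sum_mem fun c _ => W.smul_mem _ (hW (tvEquiv z c) (tvEquiv_symp z c) h hh)

lemma Eop_stable {p t m : ℕ} [Fact p.Prime] (z : Fin m) (N : ℤ)
    {W : Submodule (GaloisField p t) (SympV p t m → GaloisField p t)} (hW : SpStable W)
    {h : SympV p t m → GaloisField p t} (hh : h ∈ W) : Eop z N h ∈ W :=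
  W.sum_mem fun c _ => W.smul_mem _ (hW (torEquiv z c) (torEquiv_symp z c) h hh)

lemma units_zpow_sum (p t : ℕ) [Fact p.Prime] (ht : t ≠ 0) (N : ℤ) :
    ∑ c : (GaloisField p t)ˣ, ((c ^ N : (GaloisField p t)ˣ) : GaloisField p t) =
      if ((p : ℤ) ^ t - 1) ∣ N then -1 else 0 := by
  have hq := one_lt_q p t ht
  have hcard : Nat.card (GaloisField p t)ˣ = p ^ t - 1 := by
    rw [Nat.card_eq_fintype_card, Fintype.card_units, gal_card p t ht]
  have hc : ((p ^ t - 1 : ℕ) : ℤ) = (p : ℤ) ^ t - 1 := by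
    push_cast [Nat.cast_sub hq.le]; rfl
  obtain ⟨n, hn⟩ := Int.eq_ofNat_of_zero_le
    (Int.emod_nonneg N (b := ((p ^ t - 1 : ℕ) : ℤ)) (by omega))
  have h1 := FiniteField.sum_pow_units (GaloisField p t) n
  rw [gal_card p t ht] at h1
  have h2 : ∀ c : (GaloisField p t)ˣ, ((c ^ N : (GaloisField p t)ˣ) : GaloisField p t) =
      (c : GaloisField p t) ^ n := by
    intro c
    rw [← zpow_mod_natCard c N, hcard, hn, zpow_natCast, Units.val_pow_eq_pow_val]
  simp only [h2]
  convert h1 using 2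
  rw [← hc, ← Int.natCast_dvd_natCast (n := n)]
  rw [← hn]
  exact (EuclideanDomain.dvd_mod_iff dvd_rfl).symm

lemma Eop_eigen {p t m : ℕ} [Fact p.Prime] (ht : t ≠ 0) (z : Fin m) (N N' : ℤ)
    (h : SympV p t m → GaloisField p t)
    (hh : ∀ c v, h (tor z c v) = ((c ^ N' : (GaloisField p t)ˣ) : GaloisField p t) * h v) :
    Eop z N h = if ((p : ℤ) ^ t - 1) ∣ N' - N then h else 0 := by
  have h1 : Eop z N h = (- ∑ c : (GaloisField p t)ˣ,
      ((c ^ (N' - N) : (GaloisField p t)ˣ) : GaloisField p t)) • h := by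
    funext v
    simp only [Eop, LinearMap.coe_mk, AddHom.coe_mk, Finset.sum_apply, Pi.smul_apply, smul_eq_mul,
      hh, ← Finset.sum_neg_distrib, Finset.sum_mul]
    refine Finset.sum_congr rfl fun c _ => ?_
    rw [sub_eq_neg_add, zpow_add, Units.val_mul]; ring
  rw [h1, units_zpow_sum p t ht]
  split_ifs <;> simp

/-! ### Action of the transvection operator on products of digits -/

lemma Xop_prod {p t m : ℕ} [Fact p.Prime] (ht : t ≠ 0) (z : Fin m)
    (g : Fin t → SympV p t m → GaloisField p t)
    (D : Fin t → ℕ → SympV p t m → GaloisField p t)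
    (hD : ∀ j c v, g j (tv z c v) = ∑ u : Fin p, c ^ (u : ℕ) * D j u v)
    (r : Fin t) (a : ℕ) (ha : a < p) :
    Xop z (a * p ^ (r : ℕ)) (fun v => ∏ j, g j v ^ p ^ (j : ℕ)) =
      fun v => ∏ j, D j (if j = r then a else 0) v ^ p ^ (j : ℕ) := by
  have hp0 : 0 < p := (Fact.out : p.Prime).pos
  funext v
  rw [Xop_apply]
  have h1 : ∀ c : GaloisField p t, ∏ j, g j (tv z c v) ^ p ^ (j : ℕ) =
      ∑ u : Fin t → Fin p, c ^ (∑ j, (u j : ℕ) * p ^ (j : ℕ)) *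
        ∏ j, D j (u j) v ^ p ^ (j : ℕ) := by
    intro c
    simp only [hD, sum_pow_char_pow, mul_pow, Fintype.prod_sum, Finset.prod_mul_distrib, ← pow_mul,
      Finset.prod_pow_eq_pow_sum]
  simp only [h1, Finset.mul_sum]
  rw [Finset.sum_comm]
  have h0 : ∑ j : Fin t, (if j = r then a else 0) * p ^ (j : ℕ) = a * p ^ (r : ℕ) := by
    rw [Finset.sum_eq_single r] <;> simp +contextual
  have hlt : ∀ j : Fin t, (if j = r then a else 0) < p := by
    intro j; split_ifs <;> assumption
  have h2 : ∀ u : Fin t → Fin p, (∑ c : GaloisField p t, wt p t (a * p ^ (r : ℕ)) c *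
      (c ^ (∑ j, (u j : ℕ) * p ^ (j : ℕ)) * ∏ j, D j (u j) v ^ p ^ (j : ℕ))) =
      if u = (fun j => ⟨if j = r then a else 0, hlt j⟩) then
        ∏ j, D j (u j) v ^ p ^ (j : ℕ) else 0 := by
    intro u
    simp only [← mul_assoc, ← Finset.sum_mul]
    rw [← h0, wt_sum p t ht _ _ (base_lt _ hlt) (base_lt _ fun j => (u j).2)]
    by_cases hu : u = (fun j => ⟨if j = r then a else 0, hlt j⟩)
    · rw [if_pos hu, if_pos, one_mul]
      simp [hu]
    · rw [if_neg hu, if_neg, zero_mul]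
      intro h
      apply hu
      have := base_inj _ (fun j => (u j : ℕ)) hlt (fun j => (u j).2) h
      funext j
      apply Fin.ext
      exact (congrFun this j).symm
  simp only [h2]
  rw [Finset.sum_ite_eq' Finset.univ]
  simp

/-- The divided power of `y_z ∂/∂x_z` on a monomial. -/
def Dm {p t m : ℕ} [Fact p.Prime] (z : Fin m) (α β : Fin m → ℕ) (u : ℕ) :
    SympV p t m → GaloisField p t :=
  ((α z).choose u : GaloisField p t) •
    mono (Function.update α z (α z - u)) (Function.update β z (β z + u))

lemma mono_split {p t m : ℕ} [Fact p.Prime] (z : Fin m) (α β : Fin m → ℕ) (v : SympV p t m) :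
    mono α β v = v.1 z ^ α z * v.2 z ^ β z *
      ∏ i ∈ Finset.univ.erase z, (v.1 i ^ α i * v.2 i ^ β i) := by
  unfold mono
  rw [← Finset.mul_prod_erase Finset.univ _ (Finset.mem_univ z)]

lemma mono_update {p t m : ℕ} [Fact p.Prime] (z : Fin m) (α β : Fin m → ℕ) (a b : ℕ)
    (v : SympV p t m) :
    mono (Function.update α z a) (Function.update β z b) v = v.1 z ^ a * v.2 z ^ b *
      ∏ i ∈ Finset.univ.erase z, (v.1 i ^ α i * v.2 i ^ β i) := by
  rw [mono_split z]
  simp only [Function.update_self]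
  congr 1
  refine Finset.prod_congr rfl fun i hi => ?_
  rw [Function.update_of_ne (Finset.ne_of_mem_erase hi),
    Function.update_of_ne (Finset.ne_of_mem_erase hi)]

lemma mono_tv {p t m : ℕ} [Fact p.Prime] (z : Fin m) (α β : Fin m → ℕ) (hα : α z < p)
    (c : GaloisField p t) (v : SympV p t m) :
    mono α β (tv z c v) = ∑ u : Fin p, c ^ (u : ℕ) * Dm z α β u v := by
  rw [mono_split z]
  have h1 : ∏ i ∈ Finset.univ.erase z, ((tv z c v).1 i ^ α i * (tv z c v).2 i ^ β i) =
      ∏ i ∈ Finset.univ.erase z, (v.1 i ^ α i * v.2 i ^ β i) := by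
    refine Finset.prod_congr rfl fun i hi => ?_
    simp [tv, Finset.ne_of_mem_erase hi]
  rw [h1]
  simp only [Dm, Pi.smul_apply, smul_eq_mul, mono_update]
  rw [Fin.sum_univ_eq_sum_range (fun u => c ^ u * (((α z).choose u : GaloisField p t) *
    (v.1 z ^ (α z - u) * v.2 z ^ (β z + u) *
      ∏ i ∈ Finset.univ.erase z, (v.1 i ^ α i * v.2 i ^ β i)))) p]
  rw [← Finset.sum_subset (s₁ := Finset.range (α z + 1))
    (Finset.range_subset_range.2 (by omega))]
  · have h2 : (tv z c v).1 z = c * v.2 z + v.1 z := by simp [tv, add_comm]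
    have h3 : (tv z c v).2 z = v.2 z := rfl
    rw [h2, h3, add_pow, Finset.sum_mul, Finset.sum_mul]
    refine Finset.sum_congr rfl fun u _ => ?_
    rw [mul_pow, pow_add]; ring
  · intro u _ hu
    rw [Nat.choose_eq_zero_of_lt (by simpa using hu)]
    simp

lemma mono_tor {p t m : ℕ} [Fact p.Prime] (z : Fin m) (α β : Fin m → ℕ)
    (c : (GaloisField p t)ˣ) (v : SympV p t m) :
    mono α β (tor z c v) =
      ((c ^ ((α z : ℤ) - β z) : (GaloisField p t)ˣ) : GaloisField p t) * mono α β v := by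
  rw [mono_split z, mono_split z]
  have h1 : ∏ i ∈ Finset.univ.erase z, ((tor z c v).1 i ^ α i * (tor z c v).2 i ^ β i) =
      ∏ i ∈ Finset.univ.erase z, (v.1 i ^ α i * v.2 i ^ β i) := by
    refine Finset.prod_congr rfl fun i hi => ?_
    simp [tor, Finset.ne_of_mem_erase hi]
  rw [h1]
  have h2 : (tor z c v).1 z = c * v.1 z := by simp [tor]
  have h3 : (tor z c v).2 z = ((c⁻¹ : (GaloisField p t)ˣ) : GaloisField p t) * v.2 z := by
    simp [tor]
  have h4 : ((c ^ ((α z : ℤ) - β z) : (GaloisField p t)ˣ) : GaloisField p t) =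
      (c : GaloisField p t) ^ α z * ((c⁻¹ : (GaloisField p t)ˣ) : GaloisField p t) ^ β z := by
    rw [zpow_sub, zpow_natCast, zpow_natCast, Units.val_mul, ← inv_pow, Units.val_pow_eq_pow_val,
      Units.val_pow_eq_pow_val]
  rw [h2, h3, h4, mul_pow, mul_pow]; ring


/-! ### Combinatorics of `H`-types -/

lemma cyc_up {t : ℕ} [NeZero t] (P : Fin t → Prop) (h : ∀ j, P j → P (j + 1)) (j0 : Fin t)
    (h0 : P j0) : ∀ j, P j := by
  have h1 : ∀ n : ℕ, P (j0 + Fin.ofNat t n) := by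
    intro n
    induction n with
    | zero => 
      have : j0 + Fin.ofNat t 0 = j0 := by simp
      rwa [this]
    | succ n ih =>
      have : j0 + Fin.ofNat t (n + 1) = j0 + Fin.ofNat t n + 1 := by
        rw [add_assoc]; congr 1
        apply Fin.ext
        simp [Fin.val_add, Fin.ofNat]
      rw [this]; exact h _ ih
  intro j
  have := h1 (j - j0).val
  rwa [Fin.ofNat_val_eq_self, add_sub_cancel] at this

lemma cyc_down {t : ℕ} [NeZero t] (P : Fin t → Prop) (h : ∀ j, P (j + 1) → P j) (j0 : Fin t)
    (h0 : P j0) : ∀ j, P j := by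
  have := cyc_up (fun j => P (-j)) (fun j hj => by
    apply h; rw [neg_add, neg_add_cancel_right]; exact hj) (-j0) (by simpa using h0)
  intro j
  simpa using this (-j)

lemma add_one_ne {t : ℕ} [NeZero t] (ht : 1 < t) (j : Fin t) : j + 1 ≠ j := by
  intro h
  have h1 : (1 : Fin t) = 0 := by simpa using h
  have h2 := congrArg Fin.val h1
  rw [Fin.val_one', Nat.mod_eq_of_lt ht] at h2
  simp at h2

/-- Lowering one coordinate by one. -/
def dec {t : ℕ} (s : Fin t → ℤ) (i : Fin t) : Fin t → ℤ := Function.update s i (s i - 1)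

lemma dec_self {t : ℕ} (s : Fin t → ℤ) (i : Fin t) : dec s i i = s i - 1 := by simp [dec]

lemma dec_ne {t : ℕ} (s : Fin t → ℤ) {i l : Fin t} (h : l ≠ i) : dec s i l = s l := by
  simp [dec, h]

lemma dec_le {t : ℕ} (s : Fin t → ℤ) (i l : Fin t) : dec s i l ≤ s l := by
  by_cases h : l = i
  · subst h; rw [dec_self]; omega
  · rw [dec_ne s h]

lemma lamOf_dec {p t d : ℕ} [NeZero t] (ht : 1 < t) (s : Fin t → ℤ) (j l : Fin t) :
    lamOf p t d (dec s (j + 1)) l =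
      lamOf p t d s l - (if l = j then (p : ℤ) else 0) + (if l = j + 1 then 1 else 0) := by
  unfold lamOf
  by_cases h1 : l = j
  · subst h1
    rw [dec_self, dec_ne s (add_one_ne ht l).symm, if_pos rfl, if_neg (add_one_ne ht l).symm]
    ring
  · have h1' : l + 1 ≠ j + 1 := fun h => h1 (by simpa using h)
    rw [dec_ne s h1', if_neg h1]
    by_cases h2 : l = j + 1
    · subst h2; rw [dec_self, if_pos rfl]; ring
    · rw [dec_ne s h2, if_neg h2]; ring

/-- Uniform description of `H[d]` (`d ≠ 0`) and `H` (`d = 0`). -/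
def memHc (p t m d : ℕ) [NeZero t] (s : Fin t → ℤ) : Prop :=
  (∀ j, (if d = 0 then 1 else 0) ≤ s j ∧ s j ≤ 2 * m - 1) ∧
  (∀ j, 0 ≤ lamOf p t d s j ∧ lamOf p t d s j ≤ 2 * m * ((p : ℤ) - 1))

lemma memCase_iff (p t m d : ℕ) [NeZero t] (s : Fin t → ℤ) (eps : Finset (Fin t)) :
    memCase p t m d s eps ↔ memHc p t m d s ∧ eps ⊆ Jset p t m d s := by
  unfold memCase memHc
  by_cases h : d = 0
  · subst h; simp [memS, memH]
  · simp [h, memSd, memHd]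

lemma digitp_lt (p d j : ℕ) (hp : 0 < p) : digitp p d j < p := Nat.mod_lt _ hp

lemma digits_top (p d n : ℕ) (hp : 0 < p) (h : ∀ j < n, digitp p d j = p - 1) :
    d % p ^ n = p ^ n - 1 := by
  induction n with
  | zero => simp [Nat.mod_one]
  | succ n ih =>
    rw [Nat.mod_pow_succ, ih fun j hj => h j (by omega)]
    have := h n (by omega)
    unfold digitp at this
    rw [this, pow_succ]
    have h1 : 0 < p ^ n := by positivity
    obtain ⟨k, rfl⟩ : ∃ k, p = k + 1 := ⟨p - 1, by omega⟩
    simp only [Nat.add_sub_cancel]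
    rw [mul_add, mul_one]
    omega

lemma digits_zero (p d n : ℕ) (h : ∀ j < n, digitp p d j = 0) : d % p ^ n = 0 := by
  induction n with
  | zero => simp [Nat.mod_one]
  | succ n ih =>
    rw [Nat.mod_pow_succ, ih fun j hj => h j (by omega)]
    have := h n (by omega)
    unfold digitp at this
    rw [this]; simp

lemma exists_digit_lt (p t d : ℕ) [Fact p.Prime] (ht : 1 < t) (hd : d ≤ p ^ t - 2) :
    ∃ j : Fin t, digitp p d j + 2 ≤ p := by
  by_contra hcon
  push Not at hcon
  have hp : 1 < p := (Fact.out : p.Prime).one_lt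
  have h1 := digits_top p d t (by omega) (fun j hj => by
    have h1 := hcon ⟨j, hj⟩
    have h2 := digitp_lt p d j (by omega)
    simp only at h1
    omega)
  have h2 := one_lt_q p t (by omega)
  rw [Nat.mod_eq_of_lt (by omega)] at h1
  omega

lemma digits_eq_zero (p t d : ℕ) [Fact p.Prime] (ht : 1 < t) (hd : d ≤ p ^ t - 2)
    (h : ∀ j : Fin t, digitp p d j = 0) : d = 0 := by
  have h1 := digits_zero p d t (fun j hj => h ⟨j, hj⟩)
  have h2 := one_lt_q p t (by omega)
  rwa [Nat.mod_eq_of_lt (by omega)] at h1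

lemma lamOf_inj {p t d : ℕ} [Fact p.Prime] [NeZero t] (s s' : Fin t → ℤ)
    (h : ∀ j, lamOf p t d s j = lamOf p t d s' j) : s = s' := by
  have hp : 1 < p := (Fact.out : p.Prime).one_lt
  obtain ⟨j0, hj0⟩ := Finite.exists_max (fun j => |s j - s' j|)
  have h1 := h (j0 - 1)
  unfold lamOf at h1
  rw [sub_add_cancel] at h1
  have h2 : s (j0 - 1) - s' (j0 - 1) = p * (s j0 - s' j0) := by linarith
  have h3 := hj0 (j0 - 1)
  rw [h2, abs_mul, Nat.abs_cast] at h3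
  have h4 : |s j0 - s' j0| = 0 := by
    have h5 := abs_nonneg (s j0 - s' j0)
    have : (2 : ℤ) ≤ p := by exact_mod_cast hp
    nlinarith
  funext j
  have h5 := hj0 j
  rw [h4] at h5
  have := abs_nonpos_iff.1 h5
  linarith

/-- Types in range give elements of `H[d]`. -/
lemma memHc_of_lam {p t m d : ℕ} [Fact p.Prime] [NeZero t] (ht : 1 < t) (hd : d ≤ p ^ t - 2)
    (s s1 : Fin t → ℤ) (hs : memHc p t m d s) (hle : ∀ j, s1 j ≤ s j)
    (hlam : ∀ j, 0 ≤ lamOf p t d s1 j ∧ lamOf p t d s1 j ≤ 2 * m * ((p : ℤ) - 1))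
    (j1 : Fin t) (hj1 : 1 ≤ lamOf p t d s1 j1) : memHc p t m d s1 := by
  have hp : (2 : ℤ) ≤ p := by exact_mod_cast (Fact.out : p.Prime).two_le
  refine ⟨fun j => ⟨?_, (hle j).trans (hs.1 j).2⟩, hlam⟩
  have hdig : ∀ j : Fin t, (digitp p d j : ℤ) ≤ p - 1 := by
    intro j; have := digitp_lt p d j (by omega); omega
  have hnn : ∀ j, 0 ≤ s1 j := by
    obtain ⟨j0, hj0⟩ := Finite.exists_min s1
    have hlow : ∀ j, -1 ≤ s1 j := by
      intro j
      refine le_trans ?_ (hj0 j)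
      have h1 := (hlam (j0 - 1)).1
      unfold lamOf at h1
      rw [sub_add_cancel] at h1
      have h2 := hj0 (j0 - 1)
      have h3 := hdig (j0 - 1)
      nlinarith
    by_contra hcon
    push Not at hcon
    obtain ⟨j, hj⟩ := hcon
    have hall : ∀ j, s1 j = -1 := by
      apply cyc_down (fun j => s1 j = -1) _ j (by have := hlow j; omega)
      intro j hj
      have h1 := (hlam j).1
      unfold lamOf at h1
      rw [hj] at h1
      have h3 := hdig j
      have := hlow j
      linarith
    obtain ⟨j2, hj2⟩ := exists_digit_lt p t d ht hd
    have h1 := (hlam j2).1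
    unfold lamOf at h1
    rw [hall, hall] at h1
    omega
  by_cases hd0 : d = 0
  · rw [if_pos hd0]
    subst hd0
    have hz : ∀ j : Fin t, digitp p 0 j = 0 := by intro j; simp [digitp]
    by_contra hcon
    have h0 : s1 j = 0 := by have := hnn j; omega
    have hall : ∀ j, s1 j = 0 := by
      apply cyc_down (fun j => s1 j = 0) _ j h0
      intro j hj
      have h1 := (hlam j).1
      unfold lamOf at h1
      rw [hj, hz] at h1
      have := hnn j
      push_cast at h1
      linarith
    unfold lamOf at hj1
    rw [hall, hall, hz] at hj1
    simp at hj1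
  · rw [if_neg hd0]; exact hnn j

/-- Between two comparable elements one can lower a single coordinate. -/
lemma exists_dec {p t m d : ℕ} [Fact p.Prime] [NeZero t] (hm : 2 ≤ m)
    (ht : 1 < t) (hd : d ≤ p ^ t - 2)
    (s s0 : Fin t → ℤ) (hs : memHc p t m d s) (hs0 : memHc p t m d s0) (hle : ∀ j, s0 j ≤ s j)
    (hne : s0 ≠ s) : ∃ j, s0 (j + 1) < s (j + 1) ∧ memHc p t m d (dec s (j + 1)) := by
  have hp : (2 : ℤ) ≤ p := by exact_mod_cast (Fact.out : p.Prime).two_le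
  have hm' : (2 : ℤ) ≤ m := by exact_mod_cast hm
  have hdig : ∀ j : Fin t, (digitp p d j : ℤ) ≤ p - 1 := by
    intro j; have := digitp_lt p d j (by omega); omega
  by_contra hcon
  push Not at hcon
  have hfail : ∀ j, s0 (j + 1) < s (j + 1) →
      lamOf p t d s (j + 1) = 2 * m * ((p : ℤ) - 1) ∨ lamOf p t d s j < p := by
    intro j hj
    by_contra h
    push Not at h
    apply hcon j hj
    refine ⟨fun l => ?_, fun l => ?_⟩
    · refine ⟨?_, (dec_le s _ l).trans (hs.1 l).2⟩
      by_cases hl : l = j + 1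
      · subst hl
        rw [dec_self]
        have := (hs0.1 (j + 1)).1
        split_ifs at this ⊢ <;> omega
      · rw [dec_ne s hl]; exact (hs.1 l).1
    · rw [lamOf_dec ht]
      have h1 := hs.2 l
      by_cases h2 : l = j
      · subst h2
        rw [if_pos rfl, if_neg (add_one_ne ht l).symm]
        constructor <;> linarith [h.2, h1.2]
      · rw [if_neg h2]
        by_cases h3 : l = j + 1
        · subst h3
          rw [if_pos rfl]
          have := lt_of_le_of_ne h1.2 h.1
          constructor <;> omega
        · rw [if_neg h3]
          constructor <;> linarith [h1.1, h1.2]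
  obtain ⟨j0, hj0⟩ := Function.ne_iff.1 hne
  have hj0' : s0 (j0 - 1 + 1) < s (j0 - 1 + 1) := by
    rw [sub_add_cancel]; exact lt_of_le_of_ne (hle j0) hj0
  by_cases hA : ∃ j, s0 j < s j ∧ lamOf p t d s j = 2 * m * ((p : ℤ) - 1)
  · obtain ⟨j, hj⟩ := hA
    have hall : ∀ j, s0 j < s j ∧ lamOf p t d s j = 2 * m * ((p : ℤ) - 1) := by
      refine cyc_up _ ?_ j hj
      rintro j ⟨h1, h2⟩
      have h3 : s0 (j + 1) < s (j + 1) := by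
        have h4 := (hs0.2 j).2
        rw [← h2] at h4
        unfold lamOf at h4
        by_contra h5
        have h6 : s0 (j + 1) = s (j + 1) := le_antisymm (hle _) (by omega)
        rw [h6] at h4
        linarith
      refine ⟨h3, (hfail j h3).resolve_right ?_⟩
      rw [h2]
      nlinarith
    obtain ⟨j2, hj2⟩ := exists_digit_lt p t d ht hd
    obtain ⟨j1, hj1⟩ := Finite.exists_min s
    have hs1 : 2 * (m : ℤ) - 1 ≤ s j1 := by
      have h1 := (hall (j1 - 1)).2
      unfold lamOf at h1
      rw [sub_add_cancel] at h1
      have h2 := hj1 (j1 - 1)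
      have h3 := hdig (j1 - 1)
      by_contra h4
      have h5 : s j1 ≤ 2 * m - 2 := by omega
      nlinarith
    have hs2 : ∀ j, s j = 2 * m - 1 := fun j =>
      le_antisymm (hs.1 j).2 (hs1.trans (hj1 j))
    have h1 := (hall j2).2
    unfold lamOf at h1
    rw [hs2, hs2] at h1
    have : (digitp p d j2 : ℤ) = p - 1 := by linarith
    omega
  · push Not at hA
    have hall : ∀ j, s0 (j + 1) < s (j + 1) ∧ lamOf p t d s j < p := by
      refine cyc_down _ ?_ (j0 - 1) ⟨hj0', (hfail _ hj0').resolve_left (hA _ hj0')⟩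
      rintro j ⟨h1, h2⟩
      have hk : s0 (j + 1) < s (j + 1) := by
        have h3 := (hs0.2 (j + 1)).1
        by_contra h5
        have h6 : s0 (j + 1) = s (j + 1) := le_antisymm (hle _) (by omega)
        unfold lamOf at h3 h2
        rw [h6] at h3
        have : s0 (j + 1 + 1) ≤ s (j + 1 + 1) - 1 := by omega
        nlinarith
      exact ⟨hk, (hfail j hk).resolve_left (hA _ hk)⟩
    obtain ⟨j1, hj1⟩ := Finite.exists_max s
    have hs1 : s j1 ≤ 1 := by
      have h1 := (hall (j1 - 1)).2
      unfold lamOf at h1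
      rw [sub_add_cancel] at h1
      have h2 := hj1 (j1 - 1)
      have h3 : (0 : ℤ) ≤ digitp p d ((j1 - 1 : Fin t) : ℕ) := by positivity
      by_contra h4
      have h5 : 2 ≤ s j1 := by omega
      nlinarith
    have hlt : ∀ j, s0 j < s j := by
      intro j
      have := (hall (j - 1)).1
      rwa [sub_add_cancel] at this
    by_cases hd0 : d = 0
    · have h1 := (hs0.1 j1).1
      rw [if_pos hd0] at h1
      have := hlt j1
      omega
    · have hs2 : ∀ j, s j = 1 := by
        intro j
        have h1 := (hs0.1 j).1
        rw [if_neg hd0] at h1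
        have h2 := hlt j
        have h3 := (hj1 j).trans hs1
        omega
      apply hd0
      apply digits_eq_zero p t d ht hd
      intro j
      have h1 := (hall j).2
      unfold lamOf at h1
      rw [hs2, hs2] at h1
      omega

lemma leSd_refl_eq {p t m d : ℕ} [NeZero t] {s : Fin t → ℤ} {eps eps' : Finset (Fin t)}
    (h : leSd p t m d s eps' s eps) (h1 : eps ⊆ Jset p t m d s) (h2 : eps' ⊆ Jset p t m d s) :
    eps' = eps := by
  have hZ : Zset p t m d s s = Jset p t m d s := by
    unfold Zset Jset; simp
  have h3 := h.2
  rw [hZ, Finset.inter_eq_left.2 h1, Finset.inter_eq_left.2 h2] at h3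
  exact h3.symm

/-- Elements immediately below differ by one in exactly one coordinate. -/
lemma immBelow_dec {p t m d : ℕ} [Fact p.Prime] [NeZero t] (hm : 2 ≤ m)
    (ht : 1 < t) (hd : d ≤ p ^ t - 2)
    {s s' : Fin t → ℤ} {eps eps' : Finset (Fin t)} (hmem : memCase p t m d s eps)
    (himm : ImmBelow p t m d s' eps' s eps) : ∃ r, s' = dec s (r + 1) := by
  obtain ⟨⟨hmem', hle, hne⟩, hno⟩ := himm
  have hs := ((memCase_iff ..).1 hmem)
  have hs' := ((memCase_iff ..).1 hmem')
  have hss : s' ≠ s := by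
    rintro rfl
    exact hne ⟨rfl, leSd_refl_eq hle hs.2 hs'.2⟩
  obtain ⟨r, hr, hr2⟩ := exists_dec hm ht hd s s' hs.1 hs'.1 hle.1 hss
  refine ⟨r, ?_⟩
  by_contra hcon
  apply hno
  set s1 := dec s (r + 1) with hs1
  have hs's1 : ∀ j, s' j ≤ s1 j := by
    intro j
    by_cases hj : j = r + 1
    · subst hj; rw [hs1, dec_self]; omega
    · rw [hs1, dec_ne s hj]; exact hle.1 j
  have hs1s : ∀ j, s1 j ≤ s j := dec_le s (r + 1)
  refine ⟨s1, (Jset p t m d s1).filter (fun j => if j ∈ Zset p t m d s' s1 then j ∈ eps'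
    else j ∈ eps), ⟨(memCase_iff ..).2 ⟨hr2, Finset.filter_subset _ _⟩, ⟨hs1s, ?_⟩, ?_⟩,
    hmem', ⟨hs's1, ?_⟩, ?_⟩
  · ext j
    simp only [Finset.mem_inter, Finset.mem_filter]
    refine ⟨fun ⟨h1, h2⟩ => ⟨⟨?_, ?_⟩, h2⟩, fun ⟨⟨h1, h3⟩, h2⟩ => ⟨?_, h2⟩⟩
    · simp only [Zset, Finset.mem_filter] at h2
      simp only [Jset, Finset.mem_filter]
      exact ⟨Finset.mem_univ _, h2.2.2.2⟩
    · split_ifs with h4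
      · have hj : j ∈ Zset p t m d s' s := by
          simp only [Zset, Finset.mem_filter] at h2 h4 ⊢
          exact ⟨Finset.mem_univ _, h4.2.1.trans h2.2.1, h4.2.2.1.trans h2.2.2.1, h4.2.2.2⟩
        have : j ∈ eps ∩ Zset p t m d s' s := Finset.mem_inter.2 ⟨h1, hj⟩
        rw [hle.2] at this
        exact (Finset.mem_inter.1 this).1
      · exact h1
    · split_ifs at h3 with h4
      · have hj : j ∈ Zset p t m d s' s := by
          simp only [Zset, Finset.mem_filter] at h2 h4 ⊢
          exact ⟨Finset.mem_univ _, h4.2.1.trans h2.2.1, h4.2.2.1.trans h2.2.2.1, h4.2.2.2⟩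
        have : j ∈ eps' ∩ Zset p t m d s' s := Finset.mem_inter.2 ⟨h3, hj⟩
        rw [← hle.2] at this
        exact (Finset.mem_inter.1 this).1
      · exact h3
  · rintro ⟨h, -⟩
    have := congrFun h (r + 1)
    rw [hs1, dec_self] at this
    omega
  · ext j
    simp only [Finset.mem_inter, Finset.mem_filter]
    refine ⟨fun ⟨⟨h1, h3⟩, h2⟩ => ⟨?_, h2⟩, fun ⟨h1, h2⟩ => ⟨⟨?_, ?_⟩, h2⟩⟩
    · rwa [if_pos h2] at h3
    · simp only [Zset, Finset.mem_filter] at h2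
      simp only [Jset, Finset.mem_filter]
      refine ⟨Finset.mem_univ _, ?_⟩
      rw [← h2.2.2.2]
      unfold lamOf
      rw [h2.2.1, h2.2.2.1]
    · rwa [if_pos h2]
  · rintro ⟨h, -⟩
    exact hcon h

/-- Any sign choice at `dec s i` which is below `(s,ε)` is immediately below. -/
lemma immBelow_of_dec {p t m d : ℕ} [NeZero t]
    {s : Fin t → ℤ} {eps eps'' : Finset (Fin t)} (hmem : memCase p t m d s eps) (i : Fin t)
    (h1 : memCase p t m d (dec s i) eps'') (h2 : leSd p t m d (dec s i) eps'' s eps) :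
    ImmBelow p t m d (dec s i) eps'' s eps := by
  have hs := ((memCase_iff ..).1 hmem)
  have hs' := ((memCase_iff ..).1 h1)
  refine ⟨⟨h1, h2, ?_⟩, ?_⟩
  · rintro ⟨h, -⟩
    have := congrFun h i
    rw [dec_self] at this
    omega
  · rintro ⟨s1, eps1, ⟨ha, hb, hc⟩, hd, he, hf⟩
    have hs1 := ((memCase_iff ..).1 ha)
    have hcase : s1 = s ∨ s1 = dec s i := by
      have hj : ∀ j, j ≠ i → s1 j = s j := by
        intro j hj
        have h3 := he.1 j
        rw [dec_ne s hj] at h3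
        exact le_antisymm (hb.1 j) h3
      have h3 := he.1 i
      rw [dec_self] at h3
      have h4 := hb.1 i
      by_cases h5 : s1 i = s i
      · left
        funext j
        by_cases h : j = i
        · rw [h, h5]
        · exact hj j h
      · right
        funext j
        by_cases h : j = i
        · rw [h, dec_self]; omega
        · rw [dec_ne s h]; exact hj j h
    rcases hcase with h | h
    · subst h
      exact hc ⟨rfl, leSd_refl_eq hb hs.2 hs1.2⟩
    · subst h
      exact hf ⟨rfl, leSd_refl_eq he hs1.2 hs'.2⟩

/-- Carries in base `p` modulo `p^t - 1`. -/
lemma exists_carry {p t : ℕ} [NeZero t] (hp : 0 < p) (Δ : Fin t → ℤ)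
    (h : ((p : ℤ) ^ t - 1) ∣ ∑ j, Δ j * (p : ℤ) ^ (j : ℕ)) :
    ∃ u : Fin t → ℤ, ∀ j, Δ j = p * u (j + 1) - u j := by
  obtain ⟨u0, hu0⟩ := h
  let F : ℕ → ℤ := fun n => if hn : n < t then Δ ⟨n, hn⟩ else 0
  have hF : ∑ n ∈ Finset.range t, F n * (p : ℤ) ^ n = ((p : ℤ) ^ t - 1) * u0 := by
    rw [← hu0, ← Fin.sum_univ_eq_sum_range (fun n => F n * (p : ℤ) ^ n) t]
    exact Finset.sum_congr rfl fun j _ => by simp [F]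
  have hp' : (p : ℤ) ≠ 0 := by exact_mod_cast hp.ne'
  have hdiv : ∀ n ≤ t, (p : ℤ) ^ n ∣ u0 + ∑ l ∈ Finset.range n, F l * (p : ℤ) ^ l := by
    intro n hn
    have h1 : u0 + ∑ l ∈ Finset.range n, F l * (p : ℤ) ^ l =
        (p : ℤ) ^ t * u0 - ∑ l ∈ Finset.Ico n t, F l * (p : ℤ) ^ l := by
      rw [← Finset.sum_range_add_sum_Ico _ hn] at hF
      linarith
    rw [h1]
    refine dvd_sub (Dvd.dvd.mul_right (pow_dvd_pow _ hn) _) (Finset.dvd_sum fun l hl => ?_)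
    exact Dvd.dvd.mul_left (pow_dvd_pow _ (Finset.mem_Ico.1 hl).1) _
  choose! U hU using hdiv
  have hU0 : U 0 = u0 := by
    have := hU 0 (Nat.zero_le _)
    simpa using this.symm
  have hUt : U t = u0 := by
    have := hU t le_rfl
    rw [hF] at this
    have h2 : (p : ℤ) ^ t * (U t - u0) = 0 := by linarith
    have := (mul_eq_zero.1 h2).resolve_left (pow_ne_zero _ hp')
    linarith
  refine ⟨fun j => U j, fun j => ?_⟩
  have h1 := hU j j.2.le
  have h2 := hU (j + 1) j.2
  rw [Finset.sum_range_succ, ← add_assoc, h1, pow_succ] at h2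
  have h3 : F j = Δ j := by simp [F]
  have h4 : Δ j = p * U (j + 1) - U j := by
    have h5 : (p : ℤ) ^ (j : ℕ) * (U j + F j - p * U (j + 1)) = 0 := by linarith
    have := (mul_eq_zero.1 h5).resolve_left (pow_ne_zero _ hp')
    linarith
  have h6 : U ((j + 1 : Fin t) : ℕ) = U ((j : ℕ) + 1) := by
    by_cases hj : (j : ℕ) + 1 < t
    · rw [Fin.val_add_one_of_lt' hj]
    · have hj' : (j : ℕ) + 1 = t := by have := j.2; omega
      have : ((j + 1 : Fin t) : ℕ) = 0 := by
        rw [Fin.val_add, Fin.val_one', Nat.add_mod_mod, hj', Nat.mod_self]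
      rw [this, hj', hU0, hUt]
  change Δ j = p * U ((j + 1 : Fin t) : ℕ) - U j
  rw [h4, h6]

/-- The bad weight configuration does not occur. -/
lemma weight_contra {p t : ℕ} [NeZero t] (hp : 3 ≤ p) (c c' : Fin t → ℤ) (r : Fin t)
    (hc0 : ∀ j, j ≠ r + 1 → c j = 0) (hcr : c r = 0)
    (hci : c (r + 1) = 1 ∨ (c (r + 1) = 0 ∧ c' (r + 1) ≤ 1))
    (hc' : ∀ j, |c' j| ≤ p - 1) (hbad : c' r = p - 1)
    (hdvd : ((p : ℤ) ^ t - 1) ∣ ∑ j, c' j * (p : ℤ) ^ (j : ℕ) - ∑ j, c j * (p : ℤ) ^ (j : ℕ)) :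
    False := by
  have hp' : (3 : ℤ) ≤ p := by exact_mod_cast hp
  rw [← Finset.sum_sub_distrib] at hdvd
  simp only [← sub_mul] at hdvd
  obtain ⟨u, hu⟩ := exists_carry (by omega) _ hdvd
  have hcb : ∀ j, 0 ≤ c j ∧ c j ≤ 1 := by
    intro j
    by_cases h : j = r + 1
    · subst h; rcases hci with h | h <;> omega
    · rw [hc0 j h]; simp
  have hc'b : ∀ j, -((p : ℤ) - 1) ≤ c' j ∧ c' j ≤ p - 1 := fun j => abs_le.1 (hc' j)
  have hu1 : ∀ j, u j ≤ 1 := by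
    obtain ⟨j0, hj0⟩ := Finite.exists_max u
    intro j
    refine (hj0 j).trans ?_
    have h1 := hu (j0 - 1)
    rw [sub_add_cancel] at h1
    have h2 := hj0 (j0 - 1)
    have h3 := hcb (j0 - 1)
    have h4 := hc'b (j0 - 1)
    by_contra h5
    have : 2 ≤ u j0 := by omega
    nlinarith
  have hu2 : ∀ j, -1 ≤ u j := by
    obtain ⟨j0, hj0⟩ := Finite.exists_min u
    intro j
    refine le_trans ?_ (hj0 j)
    have h1 := hu (j0 - 1)
    rw [sub_add_cancel] at h1
    have h2 := hj0 (j0 - 1)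
    have h3 := hcb (j0 - 1)
    have h4 := hc'b (j0 - 1)
    by_contra h5
    have : u j0 ≤ -2 := by omega
    nlinarith
  have hr := hu r
  rw [hbad, hcr] at hr
  have hr1 : u (r + 1) = 1 := by
    have h1 := hu1 (r + 1)
    have h2 := hu2 r
    by_contra h3
    have : u (r + 1) ≤ 0 := by omega
    nlinarith
  have hall : ∀ j, u j = 1 := by
    refine cyc_down _ ?_ (r + 1) hr1
    intro j hj
    have h1 := hu j
    rw [hj] at h1
    have h2 := hu1 j
    have h3 := hcb j
    have h4 := hc'b j
    linarith
  have h1 := hu (r + 1)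
  rw [hall, hall] at h1
  have h4 := hc'b (r + 1)
  rcases hci with h | h
  · linarith
  · linarith [h.1, h.2]


/-! ### Digits and spans -/

lemma digit_form {p t m lam : ℕ} [Fact p.Prime] {pl : Prop}
    {g : SympV p t m → GaloisField p t} (h : IsDigit p t m lam pl g) :
    ∃ (α β : Fin m → ℕ) (e : GaloisField p t), (∀ i, α i ≤ p - 1) ∧ (∀ i, β i ≤ p - 1) ∧
      (∑ i, α i) + (∑ i, β i) = lam ∧ (e ≠ 0 → lam = m * (p - 1)) ∧
      g = mono α β + e • mono (abar p β) (abar p α) := by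
  rcases h with ⟨_, _, α, β, h1, h2, h3, h4⟩ | ⟨h0, _, α, h1, h4⟩ | ⟨h0, α, β, h1, h2, h3, _, h4⟩
  · exact ⟨α, β, 0, h1, h2, h3, by simp, by simp [h4]⟩
  · refine ⟨α, abar p α, 0, h1, fun i => Nat.sub_le _ _, ?_, by simp, by simp [h4]⟩
    rw [h0, ← Finset.sum_add_distrib]
    have : ∀ i, α i + abar p α i = p - 1 := fun i => by have := h1 i; unfold abar; omega
    simp [this]
  · exact ⟨α, β, _, h1, h2, h3.trans h0.symm, fun _ => h0, h4⟩

lemma abar_le (p : ℕ) {m : ℕ} (α : Fin m → ℕ) (i : Fin m) : abar p α i ≤ p - 1 := Nat.sub_le _ _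

lemma abar_sum (p : ℕ) {m : ℕ} (α : Fin m → ℕ) (h : ∀ i, α i ≤ p - 1) :
    ∑ i, abar p α i + ∑ i, α i = m * (p - 1) := by
  rw [← Finset.sum_add_distrib]
  have : ∀ i, abar p α i + α i = p - 1 := fun i => by have := h i; unfold abar; omega
  simp [this]

lemma abar_abar (p : ℕ) {m : ℕ} (α : Fin m → ℕ) (h : ∀ i, α i ≤ p - 1) :
    abar p (abar p α) = α := by
  funext i; have := h i; unfold abar; omega

lemma deg_le {p m : ℕ} {α β : Fin m → ℕ} (h1 : ∀ i, α i ≤ p - 1) (h2 : ∀ i, β i ≤ p - 1) :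
    (∑ i, α i) + (∑ i, β i) ≤ 2 * m * (p - 1) := by
  have a1 : ∑ i, α i ≤ ∑ _i : Fin m, (p - 1) := Finset.sum_le_sum fun i _ => h1 i
  have a2 : ∑ i, β i ≤ ∑ _i : Fin m, (p - 1) := Finset.sum_le_sum fun i _ => h2 i
  simp at a1 a2
  nlinarith

lemma two_ne {p t : ℕ} [Fact p.Prime] (hodd : Odd p) : (2 : GaloisField p t) ≠ 0 := by
  have : CharP (GaloisField p t) p := inferInstance
  have : ((2 : ℕ) : GaloisField p t) ≠ 0 := by
    rw [Ne, CharP.cast_eq_zero_iff (GaloisField p t) p]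
    intro h
    have := Nat.le_of_dvd (by norm_num) h
    have h2 := (Fact.out : p.Prime).two_le
    have : p = 2 := le_antisymm this h2
    subst this
    exact absurd hodd (by decide)
  exact_mod_cast this

lemma mono_mem_span_digits {p t m lam : ℕ} [Fact p.Prime] (hodd : Odd p)
    {α β : Fin m → ℕ} (h1 : ∀ i, α i ≤ p - 1) (h2 : ∀ i, β i ≤ p - 1)
    (h3 : (∑ i, α i) + (∑ i, β i) = lam) :
    (mono α β : SympV p t m → GaloisField p t) ∈
      Submodule.span (GaloisField p t) {g | ∃ pl, IsDigit p t m lam pl g} := by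
  by_cases hl : lam = m * (p - 1)
  · by_cases hb : β = abar p α
    · exact Submodule.subset_span ⟨True, Or.inr (Or.inl ⟨hl, trivial, α, h1, by rw [hb]⟩)⟩
    · set e := ((-1) ^ ((∑ i, β i) + m) * factk p t α * factk p t β) with he
      have a1 : (mono α β + ((1 : GaloisField p t) * e) • mono (abar p β) (abar p α)
          : SympV p t m → GaloisField p t) ∈
          Submodule.span (GaloisField p t) {g | ∃ pl, IsDigit p t m lam pl g} :=
        Submodule.subset_span ⟨True, Or.inr (Or.inr ⟨hl, α, β, h1, h2, h3.trans hl, hb, by simp [he]⟩)⟩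
      have a2 : (mono α β + ((-1 : GaloisField p t) * e) • mono (abar p β) (abar p α)
          : SympV p t m → GaloisField p t) ∈
          Submodule.span (GaloisField p t) {g | ∃ pl, IsDigit p t m lam pl g} :=
        Submodule.subset_span ⟨False, Or.inr (Or.inr ⟨hl, α, β, h1, h2, h3.trans hl, hb, by simp [he]⟩)⟩
      have a3 := Submodule.smul_mem _ (2⁻¹ : GaloisField p t) (Submodule.add_mem _ a1 a2)
      convert a3 using 1
      have := two_ne (t := t) hodd
      funext v
      simp only [Pi.add_apply, Pi.smul_apply, smul_eq_mul]
      field_simp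
      ring
  · exact Submodule.subset_span ⟨False, Or.inl ⟨hl, id, α, β, h1, h2, h3, rfl⟩⟩

/-- The twisted product `h₀ h₁^p h₂^{p²} ⋯`. -/
def tw {p t m : ℕ} [Fact p.Prime] (h : Fin t → SympV p t m → GaloisField p t) :
    SympV p t m → GaloisField p t := fun v => ∏ j, h j v ^ p ^ (j : ℕ)

lemma tw_update {p t m : ℕ} [Fact p.Prime] (h : Fin t → SympV p t m → GaloisField p t)
    (a : Fin t) (x : SympV p t m → GaloisField p t) (v : SympV p t m) :
    tw (Function.update h a x) v =
      x v ^ p ^ (a : ℕ) * ∏ j ∈ Finset.univ.erase a, h j v ^ p ^ (j : ℕ) := by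
  unfold tw
  rw [← Finset.mul_prod_erase Finset.univ _ (Finset.mem_univ a), Function.update_self]
  congr 1
  refine Finset.prod_congr rfl fun j hj => ?_
  rw [Function.update_of_ne (Finset.ne_of_mem_erase hj)]

lemma tw_update_add {p t m : ℕ} [Fact p.Prime] (h : Fin t → SympV p t m → GaloisField p t)
    (a : Fin t) (x y : SympV p t m → GaloisField p t) :
    tw (Function.update h a (x + y)) = tw (Function.update h a x) + tw (Function.update h a y) := by
  have : CharP (GaloisField p t) p := inferInstance
  funext v
  rw [Pi.add_apply, tw_update, tw_update, tw_update, Pi.add_apply, add_pow_char_pow, add_mul]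

lemma tw_update_smul {p t m : ℕ} [Fact p.Prime] (h : Fin t → SympV p t m → GaloisField p t)
    (a : Fin t) (c : GaloisField p t) (x : SympV p t m → GaloisField p t) :
    tw (Function.update h a (c • x)) = c ^ p ^ (a : ℕ) • tw (Function.update h a x) := by
  funext v
  rw [Pi.smul_apply, tw_update, tw_update, Pi.smul_apply, smul_eq_mul, smul_eq_mul, mul_pow,
    mul_assoc]

lemma tw_update_zero {p t m : ℕ} [Fact p.Prime] (h : Fin t → SympV p t m → GaloisField p t)
    (a : Fin t) : tw (Function.update h a 0) = 0 := by
  funext v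
  rw [tw_update, Pi.zero_apply, zero_pow (pow_ne_zero _ (Fact.out : p.Prime).ne_zero), zero_mul]

lemma tw_span {p t m : ℕ} [Fact p.Prime] (P : Fin t → Set (SympV p t m → GaloisField p t))
    (M : Submodule (GaloisField p t) (SympV p t m → GaloisField p t))
    (hM : ∀ g : Fin t → SympV p t m → GaloisField p t, (∀ j, g j ∈ P j) → tw g ∈ M)
    (h : Fin t → SympV p t m → GaloisField p t)
    (hh : ∀ j, h j ∈ Submodule.span (GaloisField p t) (P j)) : tw h ∈ M := by
  have key : ∀ S : Finset (Fin t), ∀ h : Fin t → SympV p t m → GaloisField p t,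
      (∀ j ∈ S, h j ∈ Submodule.span (GaloisField p t) (P j)) → (∀ j ∉ S, h j ∈ P j) →
      tw h ∈ M := by
    intro S
    induction S using Finset.induction_on with
    | empty => intro h _ h2; exact hM h fun j => h2 j (by simp)
    | insert a S ha ih =>
      intro h h1 h2
      have h3 : ∀ x ∈ Submodule.span (GaloisField p t) (P a), tw (Function.update h a x) ∈ M := by
        intro x hx
        induction hx using Submodule.span_induction with
        | mem x hx =>
          apply ih
          · intro j hj
            rw [Function.update_of_ne (by rintro rfl; exact ha hj)]
            exact h1 j (Finset.mem_insert_of_mem hj)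
          · intro j hj
            by_cases hja : j = a
            · subst hja; rwa [Function.update_self]
            · rw [Function.update_of_ne hja]
              exact h2 j (by simp [hja, hj])
        | zero => rw [tw_update_zero]; exact M.zero_mem
        | add x y _ _ hx hy => rw [tw_update_add]; exact M.add_mem hx hy
        | smul c x _ hx => rw [tw_update_smul]; exact M.smul_mem _ hx
      have := h3 (h a) (h1 a (Finset.mem_insert_self _ _))
      rwa [Function.update_eq_self] at this
  exact key Finset.univ h (fun j _ => hh j) (fun j hj => absurd (Finset.mem_univ j) hj)

lemma pow_carry {p t : ℕ} [Fact p.Prime] [NeZero t] (x : GaloisField p t) (r : Fin t) :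
    (x ^ p ^ (r : ℕ)) ^ p = x ^ p ^ ((r + 1 : Fin t) : ℕ) := by
  rw [← pow_mul, ← pow_succ]
  by_cases hj : (r : ℕ) + 1 < t
  · rw [Fin.val_add_one_of_lt' hj]
  · have hj' : (r : ℕ) + 1 = t := by have := r.2; omega
    have : ((r + 1 : Fin t) : ℕ) = 0 := by
      rw [Fin.val_add, Fin.val_one', Nat.add_mod_mod, hj', Nat.mod_self]
    rw [this, hj', gal_pow p t (NeZero.ne t)]; simp

/-- Span of the basis functions of exact `H`-type `s1` with signed type below `(s0, eps0)`. -/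
def Yex (p t m d : ℕ) [Fact p.Prime] [NeZero t] (s1 s0 : Fin t → ℤ) (eps0 : Finset (Fin t)) :
    Submodule (GaloisField p t) (SympV p t m → GaloisField p t) :=
  Submodule.span (GaloisField p t)
    {f | ∃ eps'', memCase p t m d s1 eps'' ∧ leSd p t m d s1 eps'' s0 eps0 ∧
      IsSBF p t m (lamOfN p t d s1) eps'' f}

lemma memHc_lam {p t m d : ℕ} [NeZero t] {s : Fin t → ℤ} (h : memHc p t m d s) (j : Fin t) :
    0 ≤ lamOf p t d s j ∧ lamOf p t d s j ≤ 2 * m * ((p : ℤ) - 1) := h.2 j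

lemma lamOfN_cast {p t m d : ℕ} [NeZero t] {s : Fin t → ℤ} (h : memHc p t m d s) (j : Fin t) :
    (lamOfN p t d s j : ℤ) = lamOf p t d s j := Int.toNat_of_nonneg (memHc_lam h j).1

lemma isDigit_pl {p t m lam : ℕ} [Fact p.Prime] {pl : Prop}
    {g : SympV p t m → GaloisField p t} (h : IsDigit p t m lam pl g) (hpl : pl) :
    lam = m * (p - 1) := by
  rcases h with h | h | h
  · exact absurd hpl h.2.1
  · exact h.1
  · exact h.1

lemma isDigit_mem_Jset {p t m d : ℕ} [Fact p.Prime] [NeZero t] {s : Fin t → ℤ}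
    (hs : memHc p t m d s) {j : Fin t} {pl : Prop} {g : SympV p t m → GaloisField p t}
    (h : IsDigit p t m (lamOfN p t d s j) pl g) (hpl : pl) : j ∈ Jset p t m d s := by
  have h1 := isDigit_pl h hpl
  have h2 := lamOfN_cast hs j
  rw [h1] at h2
  have hp := (Fact.out : p.Prime).one_lt
  simp only [Jset, Finset.mem_filter, Finset.mem_univ, true_and]
  rw [← h2]; push_cast [Nat.cast_sub hp.le]; ring

lemma absorb {p t m d : ℕ} [Fact p.Prime] [NeZero t] (hodd : Odd p)
    {s0 s1 : Fin t → ℤ} {eps0 : Finset (Fin t)} (hle : ∀ j, s1 j ≤ s0 j)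
    (hs1 : memHc p t m d s1) (T : Finset (Fin t))
    (hT : ∀ l ∈ T, s1 l < s0 l ∨ s1 (l + 1) < s0 (l + 1))
    (h : Fin t → SympV p t m → GaloisField p t)
    (h1 : ∀ l ∈ T, h l ∈ Submodule.span (GaloisField p t)
      {g | ∃ α β : Fin m → ℕ, (∀ i, α i ≤ p - 1) ∧ (∀ i, β i ≤ p - 1) ∧
        (∑ i, α i) + (∑ i, β i) = lamOfN p t d s1 l ∧ g = mono α β})
    (h2 : ∀ l ∉ T, IsDigit p t m (lamOfN p t d s1 l) (l ∈ eps0) (h l)) :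
    tw h ∈ Yex p t m d s1 s0 eps0 := by
  apply tw_span (fun l => if l ∈ T then {g | ∃ pl, IsDigit p t m (lamOfN p t d s1 l) pl g}
    else {h l})
  · intro g hg
    set eps'' := Finset.univ.filter (fun l =>
      (l ∈ T ∧ IsDigit p t m (lamOfN p t d s1 l) True (g l)) ∨ (l ∉ T ∧ l ∈ eps0)) with heps
    have hdig : ∀ l, IsDigit p t m (lamOfN p t d s1 l) (l ∈ eps'') (g l) := by
      intro l
      have hgl := hg l
      by_cases hl : l ∈ T
      · rw [if_pos hl] at hgl
        obtain ⟨pl, hpl⟩ := hgl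
        by_cases hd : IsDigit p t m (lamOfN p t d s1 l) True (g l)
        · have : (l ∈ eps'') = True := by simp [heps, hl, hd]
          rwa [this]
        · have : (l ∈ eps'') = False := by simp [heps, hl, hd]
          rw [this]
          by_cases hq : pl
          · exact absurd (by simpa [hq] using hpl) hd
          · simpa [hq] using hpl
      · rw [if_neg hl] at hgl
        have e1 : g l = h l := hgl
        have : (l ∈ eps'') = (l ∈ eps0) := by simp [heps, hl]
        rw [this, e1]
        exact h2 l hl
    refine Submodule.subset_span ⟨eps'', ?_, ⟨hle, ?_⟩, g, hdig, rfl⟩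
    · rw [memCase_iff]
      exact ⟨hs1, fun l hl => isDigit_mem_Jset hs1 (hdig l) hl⟩
    · ext l
      simp only [Finset.mem_inter, and_congr_left_iff]
      intro hl
      simp only [Zset, Finset.mem_filter] at hl
      have hlT : l ∉ T := fun hlT => by
        rcases hT l hlT with h | h
        · exact absurd hl.2.1 h.ne
        · exact absurd hl.2.2.1 h.ne
      simp [heps, hlT]
  · intro l
    by_cases hl : l ∈ T
    · simp only [if_pos hl]
      refine (Submodule.span_le.2 ?_) (h1 l hl)
      rintro _ ⟨α, β, a1, a2, a3, rfl⟩
      exact mono_mem_span_digits hodd a1 a2 a3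
    · simp only [if_neg hl]
      exact Submodule.mem_span_singleton_self _

lemma Yex_le_Yltmod {p t m d : ℕ} [Fact p.Prime] [NeZero t]
    {s0 s1 : Fin t → ℤ} {eps0 : Finset (Fin t)} (hne : s1 ≠ s0) :
    Yex p t m d s1 s0 eps0 ≤ Yltmod p t m d s0 eps0 := by
  refine Submodule.span_mono ?_
  rintro f ⟨e, h1, h2, h3⟩
  exact ⟨s1, e, h1, h2, fun h => hne h.1, h3⟩

lemma sum_update_z {m : ℕ} (z : Fin m) (β : Fin m → ℕ) (b : ℕ) :
    ∑ i, Function.update β z b i + β z = ∑ i, β i + b := by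
  rw [← Finset.add_sum_erase _ _ (Finset.mem_univ z),
    ← Finset.add_sum_erase (a := z) Finset.univ β (Finset.mem_univ z), Function.update_self,
    Finset.sum_congr rfl (fun i hi => Function.update_of_ne (Finset.ne_of_mem_erase hi) b β)]
  ring

lemma mono_upd_y {p t m : ℕ} [Fact p.Prime] (z : Fin m) (α β : Fin m → ℕ) (b : ℕ)
    (v : SympV p t m) :
    mono α (Function.update β z (β z + b)) v = v.2 z ^ b * mono α β v := by
  have := mono_update z α β (α z) (β z + b) v
  rw [Function.update_eq_self] at this
  rw [this, mono_split z α β, pow_add]; ring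


lemma carry {p t m d : ℕ} [Fact p.Prime] [NeZero t] (hodd : Odd p) (ht : 1 < t)
    (hd : d ≤ p ^ t - 2) (z : Fin m)
    {s0 : Fin t → ℤ} {eps0 : Finset (Fin t)} (hs0 : memHc p t m d s0) (n : ℕ) :
    ∀ (s1 : Fin t → ℤ) (T : Finset (Fin t)) (h : Fin t → SympV p t m → GaloisField p t)
    (j : Fin t), Tᶜ.card = n → (∀ l, s1 l ≤ s0 l) →
    (∀ l ∈ T, s1 l < s0 l ∨ s1 (l + 1) < s0 (l + 1)) → s1 j < s0 j →
    (∀ l ∈ T, ∃ α β : Fin m → ℕ, (∀ i, α i ≤ p - 1) ∧ (∀ i, β i ≤ p - 1) ∧ β z + 2 ≤ p ∧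
      (((∑ i, α i) + (∑ i, β i) : ℕ) : ℤ) = lamOf p t d s1 l - (if l = j then 1 else 0) ∧
      h l = mono α β) →
    (∀ l ∉ T, ∃ lam : ℕ, (lam : ℤ) = lamOf p t d s1 l - (if l = j then 1 else 0) ∧
      IsDigit p t m lam (l ∈ eps0) (h l)) →
    (fun v => v.2 z ^ p ^ (j : ℕ) * tw h v) ∈ Yltmod p t m d s0 eps0 := by
  have hp := (Fact.out : p.Prime).one_lt
  have hcast : ∀ x : ℕ, x ≤ 2 * m * (p - 1) → (x : ℤ) ≤ 2 * m * ((p : ℤ) - 1) := by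
    intro x hx
    have h1 : ((p - 1 : ℕ) : ℤ) = (p : ℤ) - 1 := by push_cast [Nat.cast_sub hp.le]; rfl
    rw [← h1]; exact_mod_cast hx
  induction n using Nat.strong_induction_on with
  | _ n ih =>
  intro s1 T h j hn hle hT hj h1 h2
  by_cases hjT : j ∈ T
  · obtain ⟨α, β, a1, a2, a3, a4, a5⟩ := h1 j hjT
    rw [if_pos rfl] at a4
    have hβ' : ∀ i, Function.update β z (β z + 1) i ≤ p - 1 := by
      intro i
      by_cases hi : i = z
      · subst hi; rw [Function.update_self]; omega
      · rw [Function.update_of_ne hi]; exact a2 i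
    have hsum := sum_update_z z β (β z + 1)
    have hlam : ∀ l, 0 ≤ lamOf p t d s1 l ∧ lamOf p t d s1 l ≤ 2 * m * ((p : ℤ) - 1) := by
      intro l
      by_cases hl : l = j
      · subst hl
        have e : lamOf p t d s1 l =
            (((∑ i, α i) + (∑ i, Function.update β z (β z + 1) i) : ℕ) : ℤ) := by
          have : (∑ i, α i) + (∑ i, Function.update β z (β z + 1) i) =
            (∑ i, α i) + (∑ i, β i) + 1 := by omega
          rw [this]; push_cast at a4 ⊢; linarith
        rw [e]
        exact ⟨by positivity, hcast _ (deg_le a1 hβ')⟩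
      · by_cases hlT : l ∈ T
        · obtain ⟨α', β', b1, b2, b3, b4, b5⟩ := h1 l hlT
          rw [if_neg hl, sub_zero] at b4
          rw [← b4]
          exact ⟨by positivity, hcast _ (deg_le b1 b2)⟩
        · obtain ⟨lam, b4, b5⟩ := h2 l hlT
          rw [if_neg hl, sub_zero] at b4
          obtain ⟨α', β', e, b1, b2, b3, _⟩ := digit_form b5
          rw [← b4, ← b3]
          exact ⟨by positivity, hcast _ (deg_le b1 b2)⟩
    have hs1 : memHc p t m d s1 := memHc_of_lam ht hd s0 s1 hs0 hle hlam j (by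
      have : (0 : ℤ) ≤ (((∑ i, α i) + (∑ i, β i) : ℕ) : ℤ) := by positivity
      linarith)
    refine Yex_le_Yltmod (s1 := s1) (fun e => by rw [e] at hj; exact lt_irrefl _ hj) ?_
    have e1 : (fun v : SympV p t m => v.2 z ^ p ^ (j : ℕ) * tw h v) =
        tw (Function.update h j (mono α (Function.update β z (β z + 1)))) := by
      funext v
      rw [tw_update]
      have := tw_update h j (h j) v
      rw [Function.update_eq_self] at this
      rw [this, a5, mono_upd_y, mul_pow, pow_one, mul_assoc]
    rw [e1]
    refine absorb hodd hle hs1 T hT _ ?_ ?_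
    · intro l hl
      apply Submodule.subset_span
      by_cases hlj : l = j
      · subst hlj
        refine ⟨α, _, a1, hβ', ?_, Function.update_self _ _ _⟩
        have := lamOfN_cast hs1 l
        have e : (∑ i, α i) + (∑ i, Function.update β z (β z + 1) i) =
            (∑ i, α i) + (∑ i, β i) + 1 := by omega
        rw [e]; zify; push_cast at a4; linarith
      · obtain ⟨α', β', b1, b2, b3, b4, b5⟩ := h1 l hl
        rw [if_neg hlj, sub_zero] at b4
        refine ⟨α', β', b1, b2, ?_, by rw [Function.update_of_ne hlj, b5]⟩
        have := lamOfN_cast hs1 l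
        have b6 := b4.trans this.symm
        exact_mod_cast b6
    · intro l hl
      have hlj : l ≠ j := by rintro rfl; exact hl hjT
      rw [Function.update_of_ne hlj]
      obtain ⟨lam, b4, b5⟩ := h2 l hl
      rw [if_neg hlj, sub_zero] at b4
      have := lamOfN_cast hs1 l
      have b6 := b4.trans this.symm
      have b7 : lam = lamOfN p t d s1 l := by exact_mod_cast b6
      rwa [← b7]
  · obtain ⟨lam, b4, b5⟩ := h2 j hjT
    rw [if_pos rfl] at b4
    obtain ⟨α, β, e, a1, a2, a3, a4, a5⟩ := digit_form b5
    have hcard : (insert j T)ᶜ.card < n := by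
      rw [← hn]
      apply Finset.card_lt_card
      rw [Finset.compl_ssubset_compl]
      exact Finset.ssubset_insert hjT
    have key : ∀ α β : Fin m → ℕ, (∀ i, α i ≤ p - 1) → (∀ i, β i ≤ p - 1) →
        (∑ i, α i) + (∑ i, β i) = lam →
        (fun v => v.2 z ^ p ^ (j : ℕ) * tw (Function.update h j (mono α β)) v) ∈
          Yltmod p t m d s0 eps0 := by
      intro α β a1 a2 a3
      by_cases hβ : β z + 2 ≤ p
      · refine ih _ hcard s1 (insert j T) _ j rfl hle ?_ hj ?_ ?_
        · intro l hl
          rcases Finset.mem_insert.1 hl with rfl | hl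
          · exact Or.inl hj
          · exact hT l hl
        · intro l hl
          by_cases hlj : l = j
          · subst hlj
            exact ⟨α, β, a1, a2, hβ, by rw [a3, if_pos rfl, b4], Function.update_self _ _ _⟩
          · rw [Function.update_of_ne hlj]
            exact h1 l ((Finset.mem_insert.1 hl).resolve_left hlj)
        · intro l hl
          rw [Finset.mem_insert, not_or] at hl
          rw [Function.update_of_ne hl.1]
          exact h2 l hl.2
      · have hβz : β z = p - 1 := by have := a2 z; omega
        have e2 : (fun v : SympV p t m =>
            v.2 z ^ p ^ (j : ℕ) * tw (Function.update h j (mono α β)) v) =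
            fun v => v.2 z ^ p ^ ((j + 1 : Fin t) : ℕ) *
              tw (Function.update h j (mono α (Function.update β z 0))) v := by
          funext v
          rw [tw_update, tw_update]
          have : mono α β v = v.2 z ^ (p - 1) * mono α (Function.update β z 0) v := by
            rw [← mono_upd_y z α (Function.update β z 0) (p - 1) v]
            congr 1
            rw [Function.update_self, Function.update_idem, zero_add, ← hβz,
              Function.update_eq_self]
          rw [this, mul_pow, ← pow_carry]
          have e3 : (v.2 z ^ p ^ (j : ℕ)) ^ p = v.2 z ^ p ^ (j : ℕ) * (v.2 z ^ (p - 1)) ^ p ^ (j : ℕ) := by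
            rw [← pow_mul, ← pow_mul, ← pow_add]
            congr 1
            obtain ⟨q, rfl⟩ : ∃ q, p = q + 1 := ⟨p - 1, by omega⟩
            rw [Nat.add_sub_cancel]; ring
          rw [e3]; ring
        rw [e2]
        have hsum := sum_update_z z β 0
        refine ih _ hcard (dec s1 (j + 1)) (insert j T) _ (j + 1) rfl
          (fun l => (dec_le s1 _ l).trans (hle l)) ?_ ?_ ?_ ?_
        · intro l hl
          rcases Finset.mem_insert.1 hl with rfl | hl
          · right; rw [dec_self]; have := hle (l + 1); omega
          · rcases hT l hl with h | h
            · exact Or.inl ((dec_le _ _ _).trans_lt h)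
            · exact Or.inr ((dec_le _ _ _).trans_lt h)
        · rw [dec_self]; have := hle (j + 1); omega
        · intro l hl
          by_cases hlj : l = j
          · subst hlj
            refine ⟨α, Function.update β z 0, a1, ?_, by rw [Function.update_self]; omega, ?_,
              Function.update_self _ _ _⟩
            · intro i
              by_cases hi : i = z
              · subst hi; rw [Function.update_self]; omega
              · rw [Function.update_of_ne hi]; exact a2 i
            · rw [lamOf_dec ht, if_pos rfl, if_neg (add_one_ne ht l).symm]
              have : (∑ i, α i) + (∑ i, Function.update β z 0 i) + (p - 1) = lam := by omega
              zify [hp.le] at this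
              push_cast
              linarith
          · rw [Function.update_of_ne hlj]
            obtain ⟨α', β', c1, c2, c3, c4, c5⟩ :=
              h1 l ((Finset.mem_insert.1 hl).resolve_left hlj)
            refine ⟨α', β', c1, c2, c3, ?_, c5⟩
            rw [c4, lamOf_dec ht, if_neg hlj, if_neg hlj]
            split_ifs <;> ring
        · intro l hl
          rw [Finset.mem_insert, not_or] at hl
          rw [Function.update_of_ne hl.1]
          obtain ⟨lam', c4, c5⟩ := h2 l hl.2
          refine ⟨lam', ?_, c5⟩
          rw [c4, lamOf_dec ht, if_neg hl.1, if_neg hl.1]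
          split_ifs <;> ring
    have e1 : (fun v : SympV p t m => v.2 z ^ p ^ (j : ℕ) * tw h v) =
        (fun v => v.2 z ^ p ^ (j : ℕ) * tw (Function.update h j (mono α β)) v) +
        e ^ p ^ (j : ℕ) • (fun v => v.2 z ^ p ^ (j : ℕ) *
          tw (Function.update h j (mono (abar p β) (abar p α))) v) := by
      have e0 : tw h = tw (Function.update h j (h j)) := by rw [Function.update_eq_self]
      rw [e0, a5, tw_update_add, tw_update_smul]
      funext v
      simp only [Pi.add_apply, Pi.smul_apply, smul_eq_mul]
      ring
    rw [e1]
    refine Submodule.add_mem _ (key α β a1 a2 a3) ?_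
    by_cases he : e = 0
    · rw [he, zero_pow (pow_ne_zero _ (by omega)), zero_smul]
      exact Submodule.zero_mem _
    · refine Submodule.smul_mem _ _ (key _ _ (abar_le p β) (abar_le p α) ?_)
      have := a4 he
      have c1 := abar_sum p α a1
      have c2 := abar_sum p β a2
      omega


/-! ### The functional -/

/-- The sign constant of a binomial. -/
def kap (p t : ℕ) [Fact p.Prime] {m : ℕ} (α β : Fin m → ℕ) : GaloisField p t :=
  (-1) ^ ((∑ i, β i) + m) * factk p t α * factk p t β

lemma wilson_gen {p t : ℕ} [Fact p.Prime] (a : ℕ) (ha : a ≤ p - 1) :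
    ((a.factorial : ℕ) : GaloisField p t) * (((p - 1 - a).factorial : ℕ) : GaloisField p t) =
      (-1) ^ (a + 1) := by
  have hp := (Fact.out : p.Prime).one_lt
  have : CharP (GaloisField p t) p := inferInstance
  induction a with
  | zero =>
    have h1 := ZMod.wilsons_lemma p
    have h2 : (((p - 1).factorial + 1 : ℕ) : ZMod p) = 0 := by push_cast; rw [h1]; ring
    rw [ZMod.natCast_eq_zero_iff] at h2
    have h3 : (((p - 1).factorial + 1 : ℕ) : GaloisField p t) = 0 :=
      (CharP.cast_eq_zero_iff (GaloisField p t) p _).2 h2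
    push_cast at h3
    simp
    linear_combination h3
  | succ a ih =>
    have h1 := ih (by omega)
    have h2 : p - 1 - a = (p - 1 - (a + 1)) + 1 := by omega
    rw [h2, Nat.factorial_succ] at h1
    rw [Nat.factorial_succ]
    have h3 : ((p - 1 - (a + 1) + 1 : ℕ) : GaloisField p t) = -((a : GaloisField p t) + 1) := by
      have h4 : ((p - 1 - (a + 1) + 1 + (a + 1) : ℕ) : GaloisField p t) = 0 := by
        have : p - 1 - (a + 1) + 1 + (a + 1) = p := by omega
        rw [this]; exact CharP.cast_eq_zero _ p
      push_cast at h4 ⊢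
      linear_combination h4
    rw [Nat.cast_mul, h3] at h1
    push_cast
    rw [pow_succ]
    linear_combination (-1 : GaloisField p t) * h1

lemma factk_abar {p t m : ℕ} [Fact p.Prime] (α : Fin m → ℕ) (h : ∀ i, α i ≤ p - 1) :
    factk p t α * factk p t (abar p α) = (-1) ^ ((∑ i, α i) + m) := by
  unfold factk
  rw [← Finset.prod_mul_distrib]
  have : ∀ i, ((α i).factorial : GaloisField p t) * ((abar p α i).factorial : GaloisField p t) =
      (-1) ^ (α i + 1) := fun i => wilson_gen _ (h i)
  rw [Finset.prod_congr rfl fun i _ => this i, Finset.prod_pow_eq_pow_sum, Finset.sum_add_distrib]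
  simp

lemma kap_mul {p t m : ℕ} [Fact p.Prime] (hodd : Odd p) (α β : Fin m → ℕ)
    (h1 : ∀ i, α i ≤ p - 1) (h2 : ∀ i, β i ≤ p - 1) :
    kap p t α β * kap p t (abar p β) (abar p α) = 1 := by
  unfold kap
  have e1 := factk_abar (t := t) α h1
  have e2 := factk_abar (t := t) β h2
  have e3 : ((-1 : GaloisField p t)) ^ ((∑ i, β i) + m) * (-1) ^ ((∑ i, abar p α i) + m) *
      ((-1) ^ ((∑ i, α i) + m) * (-1) ^ ((∑ i, β i) + m)) = 1 := by
    rw [← pow_add, ← pow_add, ← pow_add]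
    apply Even.neg_one_pow
    have h3 := abar_sum p α h1
    obtain ⟨q, hq⟩ := hodd
    have : m * (p - 1) = 2 * (m * q) := by rw [hq, Nat.add_sub_cancel]; ring
    refine ⟨m * q + (∑ i, β i) + 2 * m, ?_⟩
    omega
  linear_combination e3 + (-1 : GaloisField p t) ^ ((∑ i, β i) + m) *
    (-1) ^ ((∑ i, abar p α i) + m) * (e1 * (factk p t β * factk p t (abar p β)) +
      (-1) ^ ((∑ i, α i) + m) * e2)

lemma tw_sum {p t m : ℕ} [Fact p.Prime] (e : Fin t → Bool → GaloisField p t)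
    (A B : Fin t → Bool → Fin m → ℕ) :
    (tw (fun j => ∑ b, e j b • mono (A j b) (B j b)) : SympV p t m → GaloisField p t) =
      ∑ χ : Fin t → Bool, (∏ j, e j (χ j) ^ p ^ (j : ℕ)) •
        tw (fun j => mono (A j (χ j)) (B j (χ j))) := by
  have : CharP (GaloisField p t) p := inferInstance
  funext v
  simp only [tw, Finset.sum_apply, Pi.smul_apply, smul_eq_mul, sum_pow_char_pow, mul_pow]
  rw [Fintype.prod_sum]
  exact Finset.sum_congr rfl fun χ _ => Finset.prod_mul_distrib

/-- The functional. -/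
def phi {p t m : ℕ} [Fact p.Prime] (c : Fin t → Bool → GaloisField p t)
    (A B : Fin t → Bool → Fin m → ℕ) :
    (SympV p t m → GaloisField p t) →ₗ[GaloisField p t] GaloisField p t :=
  ∑ χ : Fin t → Bool, (∏ j, c j (χ j) ^ p ^ (j : ℕ)) •
    coefF (fun l => ∑ j, A j (χ j) l * p ^ (j : ℕ)) (fun l => ∑ j, B j (χ j) l * p ^ (j : ℕ))

/-- The local factor of the functional. -/
def loc {k : Type*} [Field k] {m : ℕ} (c : Bool → k) (A B : Bool → Fin m → ℕ)
    (e : Bool → k) (A' B' : Bool → Fin m → ℕ) : k :=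
  ∑ b, ∑ b', if A b = A' b' ∧ B b = B' b' then c b * e b' else 0

lemma phi_tw {p t m : ℕ} [Fact p.Prime] (ht : t ≠ 0) (c : Fin t → Bool → GaloisField p t)
    (A B : Fin t → Bool → Fin m → ℕ) (e : Fin t → Bool → GaloisField p t)
    (A' B' : Fin t → Bool → Fin m → ℕ)
    (hA : ∀ j b i, A j b i ≤ p - 1) (hB : ∀ j b i, B j b i ≤ p - 1)
    (hA' : ∀ j b i, A' j b i ≤ p - 1) (hB' : ∀ j b i, B' j b i ≤ p - 1) :
    phi c A B (tw (fun j => ∑ b, e j b • mono (A' j b) (B' j b))) =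
      ∏ j, (loc (c j) (A j) (B j) (e j) (A' j) (B' j)) ^ p ^ (j : ℕ) := by
  have hp := (Fact.out : p.Prime).one_lt
  have : CharP (GaloisField p t) p := inferInstance
  rw [tw_sum, map_sum]
  simp only [loc, sum_pow_char_pow]
  rw [Fintype.prod_sum]
  simp only [Fintype.prod_sum]
  rw [Finset.sum_comm]
  refine Finset.sum_congr rfl fun χ' _ => ?_
  rw [map_smul]
  simp only [phi, LinearMap.sum_apply, LinearMap.smul_apply, smul_eq_mul, Finset.mul_sum]
  refine Finset.sum_congr rfl fun χ _ => ?_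
  have h1 := coefF_digits (p := p) (t := t) ht (fun j => A j (χ j)) (fun j => B j (χ j))
    (fun j => A' j (χ' j)) (fun j => B' j (χ' j))
    (fun j i => by have := hA j (χ j) i; omega) (fun j i => by have := hB j (χ j) i; omega)
    (fun j i => by have := hA' j (χ' j) i; omega) (fun j i => by have := hB' j (χ' j) i; omega)
  unfold tw
  rw [h1, ← Finset.prod_mul_distrib, ← Finset.prod_mul_distrib]
  refine Finset.prod_congr rfl fun j _ => ?_
  split_ifs
  · rw [mul_pow]; ring
  · rw [zero_pow (pow_ne_zero _ (by omega))]; ring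

/-- Pair of a multi-index and its conjugate (first component). -/
def pa (p : ℕ) {m : ℕ} (α β : Fin m → ℕ) (b : Bool) : Fin m → ℕ := bif b then abar p β else α
/-- Pair of a multi-index and its conjugate (second component). -/
def pb (p : ℕ) {m : ℕ} (α β : Fin m → ℕ) (b : Bool) : Fin m → ℕ := bif b then abar p α else β
/-- Pair of coefficients. -/
def pe {k : Type*} [One k] (e : k) (b : Bool) : k := bif b then e else 1

lemma pa_le {p m : ℕ} {α β : Fin m → ℕ} (h1 : ∀ i, α i ≤ p - 1) (b : Bool) (i : Fin m) :
    pa p α β b i ≤ p - 1 := by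
  cases b
  · exact h1 i
  · exact abar_le p β i

lemma pb_le {p m : ℕ} {α β : Fin m → ℕ} (h2 : ∀ i, β i ≤ p - 1) (b : Bool) (i : Fin m) :
    pb p α β b i ≤ p - 1 := by
  cases b
  · exact h2 i
  · exact abar_le p α i

lemma mono_pair {p t m : ℕ} [Fact p.Prime] (α β : Fin m → ℕ) (e : GaloisField p t) :
    (∑ b, pe e b • mono (pa p α β b) (pb p α β b) : SympV p t m → GaloisField p t) =
      mono α β + e • mono (abar p β) (abar p α) := by
  rw [Fintype.sum_bool]
  simp only [pa, pb, pe, cond_true, cond_false, one_smul]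
  exact add_comm _ _

lemma loc_deg {k : Type*} [Field k] {p m lam lam' : ℕ} {α β α' β' : Fin m → ℕ} {c e : k}
    (h1 : ∀ i, α i ≤ p - 1) (h2 : ∀ i, β i ≤ p - 1) (h3 : (∑ i, α i) + (∑ i, β i) = lam)
    (h4 : c ≠ 0 → lam = m * (p - 1))
    (h1' : ∀ i, α' i ≤ p - 1) (h2' : ∀ i, β' i ≤ p - 1)
    (h3' : (∑ i, α' i) + (∑ i, β' i) = lam') (h4' : e ≠ 0 → lam' = m * (p - 1))
    (hne : lam ≠ lam') :
    loc (pe c) (pa p α β) (pb p α β) (pe e) (pa p α' β') (pb p α' β') = 0 := by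
  have key : ∀ {α β : Fin m → ℕ} {c : k} {lam : ℕ}, (∀ i, α i ≤ p - 1) → (∀ i, β i ≤ p - 1) →
      (∑ i, α i) + (∑ i, β i) = lam → (c ≠ 0 → lam = m * (p - 1)) → ∀ b, pe c b ≠ 0 →
      (∑ i, pa p α β b i) + (∑ i, pb p α β b i) = lam := by
    intro α β c lam h1 h2 h3 h4 b hb
    cases b
    · exact h3
    · have := h4 hb
      have c1 := abar_sum p α h1
      have c2 := abar_sum p β h2
      change (∑ i, abar p β i) + (∑ i, abar p α i) = lam
      omega
  unfold loc
  refine Finset.sum_eq_zero fun b _ => Finset.sum_eq_zero fun b' _ => ?_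
  split_ifs with h
  · by_cases hb : pe c b = 0
    · rw [hb, zero_mul]
    · by_cases hb' : pe e b' = 0
      · rw [hb', mul_zero]
      · have e1 := key h1 h2 h3 h4 b hb
        have e2 := key h1' h2' h3' h4' b' hb'
        rw [h.1, h.2, e2] at e1
        exact absurd e1.symm hne
  · rfl

/-- opposite signs give zero -/
lemma loc_sign {p t m : ℕ} [Fact p.Prime] (hodd : Odd p) {α β α' β' : Fin m → ℕ}
    {σ σ' : GaloisField p t} (hσ : σ' * σ = -1) (hσ2 : σ + σ' = 0)
    (h1 : ∀ i, α i ≤ p - 1) (h2 : ∀ i, β i ≤ p - 1) (hb : β ≠ abar p α)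
    (h1' : ∀ i, α' i ≤ p - 1) (h2' : ∀ i, β' i ≤ p - 1) (hb' : β' ≠ abar p α') :
    loc (pe (σ' * kap p t (abar p β) (abar p α))) (pa p α β) (pb p α β)
      (pe (σ * kap p t α' β')) (pa p α' β') (pb p α' β') = 0 := by
  have hk := kap_mul (t := t) hodd α β h1 h2
  unfold loc
  simp only [Fintype.sum_bool, pa, pb, pe, cond_true, cond_false]
  have aa := abar_abar p α h1
  have ab := abar_abar p β h2
  have aa' := abar_abar p α' h1'
  have ab' := abar_abar p β' h2'
  by_cases c1 : α = α' ∧ β = β'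
  · obtain ⟨rfl, rfl⟩ := c1
    have n1 : ¬ (abar p β = α ∧ abar p α = β) := fun h => hb h.2.symm
    have n2 : ¬ (α = abar p β ∧ β = abar p α) := fun h => hb h.2
    simp [n1, n2]
    linear_combination hk * (σ' * σ) + hσ
  · by_cases c2 : abar p β = α' ∧ abar p α = β'
    · obtain ⟨rfl, rfl⟩ := c2
      have n2 : ¬ (abar p β = abar p (abar p α) ∧ abar p α = abar p (abar p β)) := by
        rw [aa, ab]; exact fun h => hb h.2.symm
      have n1 : (α = abar p (abar p α) ∧ β = abar p (abar p β)) := by rw [aa, ab]; simp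
      simp [n2, c1, aa, ab]
      have n3 : ¬ (abar p β = α ∧ abar p α = β) := fun h => hb h.2.symm
      simp [n3]
      linear_combination hσ2 * kap p t (abar p β) (abar p α)
    · have n1 : ¬ (abar p β = abar p β' ∧ abar p α = abar p α') := by
        rintro ⟨e1, e2⟩
        apply c1
        rw [← aa, ← ab, e1, e2, aa', ab']; simp
      have n2 : ¬ (α = abar p β' ∧ β = abar p α') := by
        rintro ⟨e1, e2⟩
        apply c2
        rw [e1, e2, aa', ab']; simp
      simp [n1, n2, c1, c2]

lemma loc_mono {p t m : ℕ} [Fact p.Prime] {α β α' : Fin m → ℕ}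
    {c : GaloisField p t} 
    (h1 : ∀ i, α i ≤ p - 1) (h2 : ∀ i, β i ≤ p - 1) (hb : β ≠ abar p α)
    (h1' : ∀ i, α' i ≤ p - 1) :
    loc (pe c) (pa p α β) (pb p α β)
      (pe 0) (pa p α' (abar p α')) (pb p α' (abar p α')) = 0 := by
  unfold loc
  simp only [Fintype.sum_bool, pa, pb, pe, cond_true, cond_false]
  have n1 : ¬ (α = α' ∧ β = abar p α') := fun h => hb (by rw [h.1, h.2])
  have n2 : ¬ (abar p β = α' ∧ abar p α = abar p α') := by
    rintro ⟨e1, e2⟩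
    apply hb
    rw [e2, ← e1, abar_abar p β h2]
  simp [n1, n2]

lemma loc_self {p t m : ℕ} [Fact p.Prime] {α β : Fin m → ℕ}
    {c e : GaloisField p t} (h : (c = 0 ∧ e = 0) ∨ β ≠ abar p α) :
    loc (pe c) (pa p α β) (pb p α β) (pe e) (pa p α β) (pb p α β) = 1 + c * e := by
  unfold loc
  simp only [Fintype.sum_bool, pa, pb, pe, cond_true, cond_false]
  rcases h with ⟨rfl, rfl⟩ | h
  · simp
  · have n1 : ¬ (abar p β = α ∧ abar p α = β) := fun h' => h h'.2.symm
    have n2 : ¬ (α = abar p β ∧ β = abar p α) := fun h' => h h'.2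
    simp [n1, n2]
    ring


/-! ### Choice of exponents -/

lemma exists_bounded {ι : Type*} [DecidableEq ι] (q : ℕ) (S : Finset ι) :
    ∀ N, N ≤ S.card * q → ∃ x : ι → ℕ, (∀ i, x i ≤ q) ∧ ∑ i ∈ S, x i = N := by
  induction S using Finset.induction_on with
  | empty => intro N hN; exact ⟨fun _ => 0, by simp, by simp at hN; simp [hN]⟩
  | insert a S ha ih =>
    intro N hN
    rw [Finset.card_insert_of_notMem ha, add_mul, one_mul] at hN
    obtain ⟨x, h1, h2⟩ := ih (N - min N q) (by omega)
    refine ⟨Function.update x a (min N q), ?_, ?_⟩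
    · intro i
      by_cases hi : i = a
      · subst hi; rw [Function.update_self]; omega
      · rw [Function.update_of_ne hi]; exact h1 i
    · have h3 : ∑ i ∈ S, Function.update x a (min N q) i = ∑ i ∈ S, x i := by
        refine Finset.sum_congr rfl (fun i hi => Function.update_of_ne ?_ _ _)
        rintro rfl
        exact ha hi
      rw [Finset.sum_insert ha, Function.update_self, h3, h2]
      omega

lemma exists_mi {q m : ℕ} (z : Fin m) (a b lam : ℕ) (ha : a ≤ q) (hb : b ≤ q)
    (h1 : a + b ≤ lam) (h2 : lam ≤ a + b + 2 * ((m - 1) * q)) :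
    ∃ α β : Fin m → ℕ, (∀ i, α i ≤ q) ∧ (∀ i, β i ≤ q) ∧ (∑ i, α i) + (∑ i, β i) = lam ∧
      α z = a ∧ β z = b := by
  have hc : (Finset.univ.erase z).card = m - 1 := by simp
  have key : ∀ N a, N ≤ (m - 1) * q → a ≤ q → ∃ α : Fin m → ℕ, (∀ i, α i ≤ q) ∧
      ∑ i, α i = a + N ∧ α z = a := by
    intro N a hN ha
    obtain ⟨x, x1, x2⟩ := exists_bounded q (Finset.univ.erase z) N (by rwa [hc])
    refine ⟨Function.update x z a, ?_, ?_, Function.update_self _ _ _⟩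
    · intro i
      by_cases hi : i = z
      · subst hi; rwa [Function.update_self]
      · rw [Function.update_of_ne hi]; exact x1 i
    · rw [← Finset.add_sum_erase _ _ (Finset.mem_univ z), Function.update_self,
        Finset.sum_congr rfl (fun i hi => Function.update_of_ne (Finset.ne_of_mem_erase hi) a x), x2]
  obtain ⟨α, a1, a2, a3⟩ := key (min (lam - (a + b)) ((m - 1) * q)) a (min_le_right _ _) ha
  obtain ⟨β, b1, b2, b3⟩ := key (lam - (a + b) - min (lam - (a + b)) ((m - 1) * q)) b
    (by omega) hb
  exact ⟨α, β, a1, b1, by omega, a3, b3⟩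

lemma exists_exponents {t q m : ℕ} [NeZero t] (ht : 1 < t) (hm : 2 ≤ m) (hq : 2 ≤ q) (z : Fin m)
    (lam : Fin t → ℕ) (r : Fin t) (hlam : ∀ j, lam j ≤ 2 * (m * q)) (hr : q + 1 ≤ lam r)
    (hi : lam (r + 1) + 1 ≤ 2 * (m * q)) :
    ∃ α β : Fin t → Fin m → ℕ, (∀ j i, α j i ≤ q) ∧ (∀ j i, β j i ≤ q) ∧
      (∀ j, (∑ i, α j i) + (∑ i, β j i) = lam j) ∧
      (β r z = q ∧ 1 ≤ α r z ∧ (α r z = q ∨ (lam r < 2 * q ∧ α r z = lam r - q))) ∧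
      ((α (r + 1) z = q ∧ β (r + 1) z = q - 1 ∧ 2 * q - 1 ≤ lam (r + 1)) ∨
        (α (r + 1) z = 1 ∧ β (r + 1) z = 0 ∧ lam (r + 1) < 2 * q - 1) ∨
        (α (r + 1) z = 0 ∧ β (r + 1) z = 0 ∧ lam (r + 1) = 0)) ∧
      (∀ j, j ≠ r → j ≠ r + 1 → α j z = β j z ∧ (α j z = q ∨ α j z = 0)) := by
  have hmq : m * q = (m - 1) * q + q := by
    obtain ⟨n, rfl⟩ : ∃ n, m = n + 1 := ⟨m - 1, by omega⟩
    rw [Nat.add_sub_cancel]; ring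
  have hmq2 : q ≤ (m - 1) * q := Nat.le_mul_of_pos_left q (by omega)
  have key : ∀ j, ∃ α β : Fin m → ℕ, (∀ i, α i ≤ q) ∧ (∀ i, β i ≤ q) ∧
      (∑ i, α i) + (∑ i, β i) = lam j ∧
      (j = r → (β z = q ∧ 1 ≤ α z ∧ (α z = q ∨ (lam r < 2 * q ∧ α z = lam r - q)))) ∧
      (j = r + 1 → ((α z = q ∧ β z = q - 1 ∧ 2 * q - 1 ≤ lam (r + 1)) ∨
        (α z = 1 ∧ β z = 0 ∧ lam (r + 1) < 2 * q - 1) ∨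
        (α z = 0 ∧ β z = 0 ∧ lam (r + 1) = 0))) ∧
      (j ≠ r → j ≠ r + 1 → α z = β z ∧ (α z = q ∨ α z = 0)) := by
    intro j
    have hj := hlam j
    by_cases h1 : j = r
    · subst h1
      obtain ⟨α, β, a1, a2, a3, a4, a5⟩ := exists_mi z (min q (lam j - q)) q (lam j)
        (min_le_left _ _) le_rfl (by omega) (by omega)
      refine ⟨α, β, a1, a2, a3, fun _ => ⟨a5, by omega, by omega⟩, ?_, by simp⟩
      intro h; exact absurd h.symm (add_one_ne ht j)
    · by_cases h2 : j = r + 1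
      · subst h2
        have : ∃ a b, a ≤ q ∧ b ≤ q ∧ a + b ≤ lam (r + 1) ∧
            lam (r + 1) ≤ a + b + 2 * ((m - 1) * q) ∧
            ((a = q ∧ b = q - 1 ∧ 2 * q - 1 ≤ lam (r + 1)) ∨
            (a = 1 ∧ b = 0 ∧ lam (r + 1) < 2 * q - 1) ∨
            (a = 0 ∧ b = 0 ∧ lam (r + 1) = 0)) := by
          by_cases c1 : 2 * q - 1 ≤ lam (r + 1)
          · exact ⟨q, q - 1, by omega, by omega, by omega, by omega, by omega⟩
          · by_cases c2 : lam (r + 1) = 0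
            · exact ⟨0, 0, by omega, by omega, by omega, by omega, by omega⟩
            · exact ⟨1, 0, by omega, by omega, by omega, by omega, by omega⟩
        obtain ⟨a, b, b1, b2, b3, b4, b5⟩ := this
        obtain ⟨α, β, a1, a2, a3, a4, a5⟩ := exists_mi z a b (lam (r + 1)) b1 b2 b3 b4
        refine ⟨α, β, a1, a2, a3, fun h => absurd h h1, ?_, by simp⟩
        intro _; rw [a4, a5]; exact b5
      · have : ∃ a, a ≤ q ∧ a + a ≤ lam j ∧
            lam j ≤ a + a + 2 * ((m - 1) * q) ∧ (a = q ∨ a = 0) := by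
          by_cases c1 : 2 * q ≤ lam j
          · exact ⟨q, by omega, by omega, by omega, by omega⟩
          · exact ⟨0, by omega, by omega, by omega, by omega⟩
        obtain ⟨a, b1, b3, b4, b5⟩ := this
        obtain ⟨α, β, a1, a2, a3, a4, a5⟩ := exists_mi z a a (lam j) b1 b1 b3 b4
        exact ⟨α, β, a1, a2, a3, fun h => absurd h h1, fun h => absurd h h2,
          fun _ _ => ⟨a4.trans a5.symm, by rw [a4]; exact b5⟩⟩
  choose α β a1 a2 a3 a4 a5 a6 using key
  exact ⟨α, β, a1, a2, a3, a4 r rfl, a5 (r + 1) rfl, a6⟩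

/-! ### Action of the operators on twisted products -/

lemma Eop_tw {p t m : ℕ} [Fact p.Prime] (ht : t ≠ 0) (z : Fin m) (N : ℤ)
    (α β : Fin t → Fin m → ℕ) (e : Fin t → GaloisField p t)
    (h1 : ∀ j i, α j i ≤ p - 1) (h2 : ∀ j i, β j i ≤ p - 1) :
    Eop z N (tw (fun j => mono (α j) (β j) + e j • mono (abar p (β j)) (abar p (α j))) :
      SympV p t m → GaloisField p t) =
      if ((p : ℤ) ^ t - 1) ∣ (∑ j, ((α j z : ℤ) - β j z) * (p : ℤ) ^ (j : ℕ)) - N then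
        tw (fun j => mono (α j) (β j) + e j • mono (abar p (β j)) (abar p (α j))) else 0 := by
  apply Eop_eigen ht
  intro c v
  unfold tw
  have hdig : ∀ j, (mono (α j) (β j) + e j • mono (abar p (β j)) (abar p (α j)) :
      SympV p t m → GaloisField p t) (tor z c v) =
      ((c ^ ((α j z : ℤ) - β j z) : (GaloisField p t)ˣ) : GaloisField p t) *
      (mono (α j) (β j) + e j • mono (abar p (β j)) (abar p (α j)) :
        SympV p t m → GaloisField p t) v := by
    intro j
    have e1 : ((abar p (β j) z : ℕ) : ℤ) - (abar p (α j) z : ℕ) = (α j z : ℤ) - β j z := by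
      have := h1 j z
      have := h2 j z
      unfold abar; omega
    simp only [Pi.add_apply, Pi.smul_apply, smul_eq_mul, mono_tor, e1]
    ring
  simp only [hdig, mul_pow]
  rw [Finset.prod_mul_distrib]
  congr 1
  simp only [← Units.val_pow_eq_pow_val]
  rw [← Units.coe_prod]
  congr 1
  have : ∀ j : Fin t, (c ^ ((α j z : ℤ) - β j z)) ^ p ^ (j : ℕ) =
      c ^ (((α j z : ℤ) - β j z) * (p : ℤ) ^ (j : ℕ)) := by
    intro j
    rw [zpow_mul, ← zpow_natCast]
    push_cast; rfl
  simp only [this]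
  have hs : ∀ (S : Finset (Fin t)) (f : Fin t → ℤ), ∏ j ∈ S, c ^ f j = c ^ ∑ j ∈ S, f j := by
    intro S f
    induction S using Finset.induction_on with
    | empty => simp
    | insert a S ha ih => rw [Finset.prod_insert ha, Finset.sum_insert ha, zpow_add, ih]
  exact hs _ _

lemma Xop_tw {p t m : ℕ} [Fact p.Prime] (ht : t ≠ 0) (z : Fin m) (r : Fin t) (a : ℕ)
    (ha : a < p) (g : Fin t → SympV p t m → GaloisField p t)
    (α β : Fin t → Fin m → ℕ) (e : Fin t → GaloisField p t)
    (h1 : ∀ j i, α j i ≤ p - 1)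
    (hg : ∀ j, g j = mono (α j) (β j) + e j • mono (abar p (β j)) (abar p (α j))) :
    Xop z (a * p ^ (r : ℕ)) (tw g) =
      tw (Function.update g r (Dm z (α r) (β r) a +
        e r • Dm z (abar p (β r)) (abar p (α r)) a)) := by
  have hp := (Fact.out : p.Prime).one_lt
  have := Xop_prod ht z g (fun j u => Dm z (α j) (β j) u +
    e j • Dm z (abar p (β j)) (abar p (α j)) u) ?_ r a ha
  · refine this.trans ?_
    funext v
    unfold tw
    refine Finset.prod_congr rfl fun j _ => ?_
    congr 1
    by_cases hj : j = r
    · subst hj; rw [Function.update_self, if_pos rfl]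
    · rw [Function.update_of_ne hj, if_neg hj, hg]
      simp [Dm]
  · intro j c v
    rw [hg]
    have b1 := h1 j z
    have b2 := abar_le p (β j) z
    simp only [Pi.add_apply, Pi.smul_apply, smul_eq_mul]
    rw [mono_tv z _ _ (by omega), mono_tv z _ _ (by omega), Finset.mul_sum,
      ← Finset.sum_add_distrib]
    exact Finset.sum_congr rfl fun u _ => by ring

/-- The coefficient used in the functional. -/
def cst (p t : ℕ) [Fact p.Prime] {m : ℕ} (lam : ℕ) (pl : Prop) (α β : Fin m → ℕ) :
    GaloisField p t :=
  if lam = m * (p - 1) then (if pl then 1 else -1) * kap p t (abar p β) (abar p α) else 0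

lemma digit_form2 {p t m lam lam' : ℕ} [Fact p.Prime] (hodd : Odd p) {pl pl' : Prop}
    {g : SympV p t m → GaloisField p t} (h : IsDigit p t m lam pl g)
    {α' β' : Fin m → ℕ} (h1 : ∀ i, α' i ≤ p - 1) (h2 : ∀ i, β' i ≤ p - 1)
    (h3 : (∑ i, α' i) + (∑ i, β' i) = lam') (h4 : lam' = m * (p - 1) → β' ≠ abar p α') :
    ∃ (α β : Fin m → ℕ) (e : GaloisField p t), (∀ i, α i ≤ p - 1) ∧ (∀ i, β i ≤ p - 1) ∧
      g = ∑ b, pe e b • mono (pa p α β b) (pb p α β b) ∧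
      ((lam ≠ lam' ∨ (lam = m * (p - 1) ∧ ¬ (pl ↔ pl'))) →
        loc (pe (cst p t lam' pl' α' β')) (pa p α' β') (pb p α' β')
          (pe e) (pa p α β) (pb p α β) = 0) := by
  have hc : cst p t lam' pl' α' β' ≠ 0 → lam' = m * (p - 1) := by
    intro hc
    by_contra hne
    exact hc (if_neg hne)
  by_cases hne : lam = lam'
  · subst hne
    rcases h with ⟨hl, _, α, β, b1, b2, b3, b4⟩ | ⟨h0, hpl, α, b1, b4⟩ |
      ⟨h0, α, β, b1, b2, b3, b5, b4⟩
    · refine ⟨α, β, 0, b1, b2, by rw [mono_pair, b4]; simp, ?_⟩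
      rintro (h | h)
      · exact absurd rfl h
      · exact absurd h.1 hl
    · refine ⟨α, abar p α, 0, b1, abar_le p α, by rw [mono_pair, b4]; simp, ?_⟩
      intro _
      exact loc_mono h1 h2 (h4 h0) b1
    · refine ⟨α, β, (if pl then 1 else -1) * kap p t α β, b1, b2, by rw [mono_pair, b4]; rfl, ?_⟩
      rintro (h | h)
      · exact absurd rfl h
      · unfold cst
        rw [if_pos h0]
        apply loc_sign hodd _ _ h1 h2 (h4 h0) b1 b2 b5
        · by_cases c1 : pl <;> by_cases c2 : pl' <;> simp_all
        · by_cases c1 : pl <;> by_cases c2 : pl' <;> simp_all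
  · obtain ⟨α, β, e, b1, b2, b3, b4, b5⟩ := digit_form h
    exact ⟨α, β, e, b1, b2, by rw [mono_pair, b5], fun _ => loc_deg h1 h2 h3 hc b1 b2 b3 b4
      (Ne.symm hne)⟩

/-- The functional attached to a target. -/
def Phi (p t m : ℕ) [Fact p.Prime] (lam : Fin t → ℕ) (eps : Finset (Fin t))
    (α β : Fin t → Fin m → ℕ) :
    (SympV p t m → GaloisField p t) →ₗ[GaloisField p t] GaloisField p t :=
  phi (fun j => pe (cst p t (lam j) (j ∈ eps) (α j) (β j)))
    (fun j => pa p (α j) (β j)) (fun j => pb p (α j) (β j))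

lemma Phi_vanish {p t m d : ℕ} [Fact p.Prime] [NeZero t] (hodd : Odd p)
    {s s' : Fin t → ℤ} {eps eps' : Finset (Fin t)} (hs : memCase p t m d s eps)
    (hs' : memCase p t m d s' eps') (hne : ¬ (s = s' ∧ eps = eps'))
    {α β : Fin t → Fin m → ℕ} (h1 : ∀ j i, α j i ≤ p - 1) (h2 : ∀ j i, β j i ≤ p - 1)
    (h3 : ∀ j, (∑ i, α j i) + (∑ i, β j i) = lamOfN p t d s' j)
    (h4 : ∀ j, lamOfN p t d s' j = m * (p - 1) → β j ≠ abar p (α j))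
    {f : SympV p t m → GaloisField p t} (hf : IsSBF p t m (lamOfN p t d s) eps f) :
    Phi p t m (lamOfN p t d s') eps' α β f = 0 := by
  have hp := (Fact.out : p.Prime).one_lt
  obtain ⟨g, hg, rfl⟩ := hf
  rw [memCase_iff] at hs hs'
  choose A B e a1 a2 a3 a4 using fun j => digit_form2 hodd (pl' := j ∈ eps') (hg j)
    (h1 j) (h2 j) (h3 j) (h4 j)
  change Phi p t m (lamOfN p t d s') eps' α β (tw g) = 0
  have : g = fun j => ∑ b, pe (e j) b • mono (pa p (A j) (B j) b) (pb p (A j) (B j) b) :=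
    funext a3
  unfold Phi
  rw [this, phi_tw (NeZero.ne t) _ _ _ _ _ _ (fun j => pa_le (h1 j)) (fun j => pb_le (h2 j))
    (fun j => pa_le (a1 j)) (fun j => pb_le (a2 j))]
  have hex : ∃ j, lamOfN p t d s j ≠ lamOfN p t d s' j ∨
      (lamOfN p t d s j = m * (p - 1) ∧ ¬ (j ∈ eps ↔ j ∈ eps')) := by
    by_contra hcon
    push Not at hcon
    have hss : s = s' := lamOf_inj (p := p) (d := d) s s' fun j => by
      rw [← lamOfN_cast hs.1 j, ← lamOfN_cast hs'.1 j, (hcon j).1]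
    subst hss
    apply hne
    refine ⟨rfl, ?_⟩
    ext j
    have hJ : j ∈ Jset p t m d s → lamOfN p t d s j = m * (p - 1) := by
      intro hj
      simp only [Jset, Finset.mem_filter, Finset.mem_univ, true_and] at hj
      have := lamOfN_cast hs.1 j
      rw [hj] at this
      zify [hp.le]
      exact this
    constructor
    · intro hj; exact ((hcon j).2 (hJ (hs.2 hj))).1 hj
    · intro hj; exact ((hcon j).2 (hJ (hs'.2 hj))).2 hj
  obtain ⟨j, hj⟩ := hex
  refine Finset.prod_eq_zero (Finset.mem_univ j) ?_
  rw [a4 j hj, zero_pow (pow_ne_zero _ (by omega))]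


/-! ### The operator on the lower layer -/

lemma Dm_zero {p t m : ℕ} [Fact p.Prime] (z : Fin m) (α β : Fin m → ℕ) (u : ℕ) (h : α z < u) :
    (Dm z α β u : SympV p t m → GaloisField p t) = 0 := by
  unfold Dm
  rw [Nat.choose_eq_zero_of_lt h]; simp

lemma Dm_top {p t m : ℕ} [Fact p.Prime] (z : Fin m) (α β : Fin m → ℕ) :
    (Dm z α β (α z) : SympV p t m → GaloisField p t) =
      mono (Function.update α z 0) (Function.update β z (β z + α z)) := by
  unfold Dm
  rw [Nat.choose_self]; simp

/-- Extracting `y_z^p` from the digit `r` and moving it to the digit `r+1`. -/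
lemma tw_extract {p t m : ℕ} [Fact p.Prime] [NeZero t] (z : Fin m) (r : Fin t)
    (h : Fin t → SympV p t m → GaloisField p t) (α β : Fin m → ℕ) (b : ℕ) :
    tw (Function.update h r (mono α (Function.update β z (b + p)))) =
      fun v => v.2 z ^ p ^ ((r + 1 : Fin t) : ℕ) *
        tw (Function.update h r (mono α (Function.update β z b))) v := by
  funext v
  rw [tw_update, tw_update]
  have := mono_upd_y z α (Function.update β z b) p v
  rw [Function.update_self, Function.update_idem] at this
  rw [this, mul_pow, ← pow_carry, ← pow_mul, ← pow_mul, mul_comm p]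
  ring

lemma upd_le {m q : ℕ} {β : Fin m → ℕ} (h : ∀ i, β i ≤ q) (z : Fin m) {b : ℕ} (hb : b ≤ q)
    (i : Fin m) : Function.update β z b i ≤ q := by
  by_cases hi : i = z
  · subst hi; rwa [Function.update_self]
  · rw [Function.update_of_ne hi]; exact h i

lemma lower {p t m d : ℕ} [Fact p.Prime] [NeZero t] (hodd : Odd p) (hp3 : 3 ≤ p) (ht : 1 < t)
    (hd : d ≤ p ^ t - 2) (z : Fin m) {s' : Fin t → ℤ} {eps' : Finset (Fin t)}
    (hs' : memHc p t m d s') (r : Fin t) (a : ℕ) (ha : a ≤ p - 1)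
    (hcase : a = p - 1 ∨ lamOfN p t d s' r < a) (c : Fin t → ℤ)
    (hc0 : a = p - 1 → ∀ j, j ≠ r + 1 → c j = 0)
    (hci : c (r + 1) = 1 ∨ (c (r + 1) = 0 ∧ lamOfN p t d s' (r + 1) ≤ 1))
    {f : SympV p t m → GaloisField p t} (hf : IsSBF p t m (lamOfN p t d s') eps' f) :
    Xop z (a * p ^ (r : ℕ)) (Eop z (∑ j, c j * (p : ℤ) ^ (j : ℕ)) f) ∈
      Yltmod p t m d s' eps' := by
  obtain ⟨g, hg, rfl⟩ := hf
  choose α β e a1 a2 a3 a4 a5 using fun j => digit_form (hg j)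
  change Xop z (a * p ^ (r : ℕ)) (Eop z (∑ j, c j * (p : ℤ) ^ (j : ℕ)) (tw g)) ∈ _
  have hE := Eop_tw (p := p) (NeZero.ne t) z (∑ j, c j * (p : ℤ) ^ (j : ℕ)) α β e a1 a2
  rw [← (funext a5 : g = _)] at hE
  rw [hE]
  split_ifs with hdvd
  swap
  · rw [map_zero]; exact Submodule.zero_mem _
  rw [Xop_tw (NeZero.ne t) z r a (by omega) g α β e a1 a5]
  have key : ∀ A B : Fin m → ℕ, (∀ i, A i ≤ p - 1) → (∀ i, B i ≤ p - 1) →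
      (∑ i, A i) + (∑ i, B i) = lamOfN p t d s' r → (A z : ℤ) - B z = (α r z : ℤ) - β r z →
      tw (Function.update g r (Dm z A B a)) ∈ Yltmod p t m d s' eps' := by
    intro A B b1 b2 b3 b4
    by_cases hA : A z < a
    · rw [Dm_zero z A B a hA, tw_update_zero]; exact Submodule.zero_mem _
    have hAs : A z ≤ ∑ i, A i := Finset.single_le_sum (fun i _ => Nat.zero_le _) (Finset.mem_univ z)
    have hap : a = p - 1 := by rcases hcase with h | h <;> omega
    have hAz : A z = a := by have := b1 z; omega
    have hBz : 1 ≤ B z := by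
      by_contra hB
      refine weight_contra hp3 c (fun j => (α j z : ℤ) - β j z) r (hc0 hap)
        (hc0 hap r (add_one_ne ht r).symm) ?_ ?_ ?_ hdvd
      · rcases hci with h | h
        · exact Or.inl h
        · refine Or.inr ⟨h.1, ?_⟩
          have h3 := a3 (r + 1)
          have : α (r + 1) z ≤ ∑ i, α (r + 1) i :=
            Finset.single_le_sum (fun i _ => Nat.zero_le _) (Finset.mem_univ z)
          have := h.2
          omega
      · intro j
        have := a1 j z
        have := a2 j z
        rw [abs_le]; constructor <;> omega
      · change (α r z : ℤ) - β r z = _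
        omega
    rw [← hAz, Dm_top]
    have e1 : B z + A z = (B z - 1) + p := by omega
    rw [e1, tw_extract]
    have hsA := sum_update_z z A 0
    have hsB := sum_update_z z B (B z - 1)
    refine carry hodd ht hd z hs' _ (dec s' (r + 1)) {r} _ (r + 1) rfl (dec_le s' _) ?_ ?_ ?_ ?_
    · intro l hl
      rw [Finset.mem_singleton] at hl
      subst hl
      right; rw [dec_self]; omega
    · rw [dec_self]; omega
    · intro l hl
      rw [Finset.mem_singleton] at hl
      subst hl
      refine ⟨_, _, upd_le b1 z (Nat.zero_le _), upd_le b2 z (b := B z - 1)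
        (by have := b2 z; omega), ?_, ?_, Function.update_self _ _ _⟩
      · rw [Function.update_self]; have := b2 z; omega
      · rw [lamOf_dec ht, if_pos rfl, if_neg (add_one_ne ht l).symm, ← lamOfN_cast hs']
        omega
    · intro l hl
      rw [Finset.mem_singleton] at hl
      refine ⟨lamOfN p t d s' l, ?_, by rw [Function.update_of_ne hl]; exact hg l⟩
      rw [lamOf_dec ht, if_neg hl, lamOfN_cast hs']
      ring
  rw [tw_update_add, tw_update_smul]
  refine Submodule.add_mem _ (key _ _ (a1 r) (a2 r) (a3 r) rfl) ?_
  by_cases he : e r = 0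
  · rw [he, zero_pow (pow_ne_zero _ (by omega)), zero_smul]
    exact Submodule.zero_mem _
  · have := a4 r he
    have c1 := abar_sum p (α r) (a1 r)
    have c2 := abar_sum p (β r) (a2 r)
    refine Submodule.smul_mem _ _ (key _ _ (abar_le p _) (abar_le p _) (by have := a3 r; omega) ?_)
    have := a1 r z
    have := a2 r z
    unfold abar; omega


/-! ### The test function -/

lemma upper {p t m d : ℕ} [Fact p.Prime] [NeZero t] (hodd : Odd p) (hp3 : 3 ≤ p) (ht : 1 < t)
    (hm : 2 ≤ m) (z : Fin m) {s : Fin t → ℤ} {eps : Finset (Fin t)} (r : Fin t)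
    (hs : memHc p t m d s) (heps : eps ⊆ Jset p t m d s)
    (hs' : memHc p t m d (dec s (r + 1))) :
    ∃ (f : SympV p t m → GaloisField p t) (a : ℕ) (c : Fin t → ℤ) (αs βs : Fin t → Fin m → ℕ),
      IsSBF p t m (lamOfN p t d s) eps f ∧ a ≤ p - 1 ∧
      (a = p - 1 ∨ lamOfN p t d (dec s (r + 1)) r < a) ∧
      (a = p - 1 → ∀ j, j ≠ r + 1 → c j = 0) ∧
      (c (r + 1) = 1 ∨ (c (r + 1) = 0 ∧ lamOfN p t d (dec s (r + 1)) (r + 1) ≤ 1)) ∧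
      (∀ j i, αs j i ≤ p - 1) ∧ (∀ j i, βs j i ≤ p - 1) ∧
      (∀ j, (∑ i, αs j i) + (∑ i, βs j i) = lamOfN p t d (dec s (r + 1)) j) ∧
      (∀ j, lamOfN p t d (dec s (r + 1)) j = m * (p - 1) → βs j ≠ abar p (αs j)) ∧
      Xop z (a * p ^ (r : ℕ)) (Eop z (∑ j, c j * (p : ℤ) ^ (j : ℕ)) f) ∈
        Yex p t m d (dec s (r + 1)) s eps ∧
      ∀ eps', leSd p t m d (dec s (r + 1)) eps' s eps →
        Phi p t m (lamOfN p t d (dec s (r + 1))) eps' αs βs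
          (Xop z (a * p ^ (r : ℕ)) (Eop z (∑ j, c j * (p : ℤ) ^ (j : ℕ)) f)) ≠ 0 := by
  have hne := add_one_ne ht r
  -- arithmetic of the types
  have hcast : ((p - 1 : ℕ) : ℤ) = (p : ℤ) - 1 := by push_cast [Nat.cast_sub (by omega : 1 ≤ p)]; rfl
  have hbd : ∀ {s : Fin t → ℤ}, memHc p t m d s → ∀ j, lamOfN p t d s j ≤ 2 * (m * (p - 1)) := by
    intro s hs j
    have h1 := (memHc_lam hs j).2
    rw [← lamOfN_cast hs j, ← hcast] at h1
    have h2 : lamOfN p t d s j ≤ 2 * m * (p - 1) := by exact_mod_cast h1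
    rwa [mul_assoc] at h2
  have hlr : lamOfN p t d (dec s (r + 1)) r + p = lamOfN p t d s r := by
    have h1 := lamOf_dec (p := p) (d := d) ht s r r
    rw [if_pos rfl, if_neg hne.symm, ← lamOfN_cast hs, ← lamOfN_cast hs'] at h1
    omega
  have hli : lamOfN p t d (dec s (r + 1)) (r + 1) = lamOfN p t d s (r + 1) + 1 := by
    have h1 := lamOf_dec (p := p) (d := d) ht s r (r + 1)
    rw [if_pos rfl, if_neg hne, ← lamOfN_cast hs, ← lamOfN_cast hs'] at h1
    omega
  have hlo : ∀ j, j ≠ r → j ≠ r + 1 → lamOfN p t d (dec s (r + 1)) j = lamOfN p t d s j := by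
    intro j h1 h2
    have h3 := lamOf_dec (p := p) (d := d) ht s r j
    rw [if_neg h2, if_neg h1, ← lamOfN_cast hs, ← lamOfN_cast hs'] at h3
    omega
  have hmq : 2 * (p - 1) ≤ m * (p - 1) := Nat.mul_le_mul_right _ hm
  obtain ⟨α, β, a1, a2, a3, ⟨ar1, ar2, ar3⟩, ai, ao⟩ := exists_exponents ht hm
    (show 2 ≤ p - 1 by omega) z (lamOfN p t d s) r (hbd hs) (by omega)
    (by have := hbd hs' (r + 1); omega)
  have hsz : ∀ j, β j ≠ abar p (α j) := by
    intro j h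
    have h1 := congrFun h z
    unfold abar at h1
    by_cases hj : j = r
    · subst hj; omega
    · by_cases hj2 : j = r + 1
      · subst hj2; omega
      · have := ao j hj hj2; omega
  set e : Fin t → GaloisField p t := fun j =>
    if lamOfN p t d s j = m * (p - 1) then (if j ∈ eps then 1 else -1) * kap p t (α j) (β j)
    else 0 with he
  set F : Fin t → SympV p t m → GaloisField p t := fun j =>
    mono (α j) (β j) + e j • mono (abar p (β j)) (abar p (α j)) with hF
  have hFd : ∀ j, IsDigit p t m (lamOfN p t d s j) (j ∈ eps) (F j) := by
    intro j
    by_cases hl : lamOfN p t d s j = m * (p - 1)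
    · refine Or.inr (Or.inr ⟨hl, α j, β j, a1 j, a2 j, (a3 j).trans hl, hsz j, ?_⟩)
      simp only [hF, he, if_pos hl]
      by_cases hje : j ∈ eps
      · simp only [if_pos hje]; rfl
      · simp only [if_neg hje]; rfl
    · refine Or.inl ⟨hl, ?_, α j, β j, a1 j, a2 j, a3 j, ?_⟩
      · intro hj
        have h1 := heps hj
        simp only [Jset, Finset.mem_filter, Finset.mem_univ, true_and] at h1
        rw [← lamOfN_cast hs, ← hcast] at h1
        exact hl (by exact_mod_cast h1)
      · simp only [hF, he, if_neg hl, zero_smul, add_zero]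
  set αs : Fin t → Fin m → ℕ := fun j => if j = r then Function.update (α r) z 0 else α j with hαs
  set βs : Fin t → Fin m → ℕ := fun j => if j = r then Function.update (β r) z (α r z - 1) else
    if j = r + 1 then Function.update (β (r + 1)) z (β (r + 1) z + 1) else β j with hβs
  have αr : αs r = Function.update (α r) z 0 := if_pos rfl
  have βr : βs r = Function.update (β r) z (α r z - 1) := if_pos rfl
  have αi : αs (r + 1) = α (r + 1) := if_neg hne
  have βi : βs (r + 1) = Function.update (β (r + 1)) z (β (r + 1) z + 1) := by
    simp [hβs, hne]
  have αo : ∀ j, j ≠ r → j ≠ r + 1 → αs j = α j := fun j h _ => if_neg h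
  have βo : ∀ j, j ≠ r → j ≠ r + 1 → βs j = β j := fun j h h2 => by
    simp only [hβs]; rw [if_neg h, if_neg h2]
  have hαs1 : ∀ j i, αs j i ≤ p - 1 := by
    intro j
    by_cases hj : j = r
    · subst hj; rw [αr]; exact upd_le (a1 _) z (Nat.zero_le _)
    · simp only [hαs]; rw [if_neg hj]; exact a1 j
  have hβs1 : ∀ j i, βs j i ≤ p - 1 := by
    intro j
    by_cases hj : j = r
    · subst hj; rw [βr]; exact upd_le (a2 _) z (by have := a1 j z; omega)
    · by_cases hj2 : j = r + 1
      · subst hj2; rw [βi]; exact upd_le (a2 _) z (by omega)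
      · rw [βo j hj hj2]; exact a2 j
  have hsum : ∀ j, (∑ i, αs j i) + (∑ i, βs j i) = lamOfN p t d (dec s (r + 1)) j := by
    intro j
    have h3 := a3 j
    by_cases hj : j = r
    · subst hj; rw [αr, βr]
      have := sum_update_z z (α j) 0
      have := sum_update_z z (β j) (α j z - 1)
      omega
    · by_cases hj2 : j = r + 1
      · subst hj2; rw [αi, βi]
        have := sum_update_z z (β (r + 1)) (β (r + 1) z + 1)
        omega
      · rw [αo j hj hj2, βo j hj hj2, hlo j hj hj2]; exact h3
  have hsr : βs r ≠ abar p (αs r) := by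
    intro h
    have h1 := congrFun h z
    unfold abar at h1
    rw [αr, βr, Function.update_self, Function.update_self] at h1
    have := a1 r z
    omega
  have hsz' : ∀ j, lamOfN p t d (dec s (r + 1)) j = m * (p - 1) → βs j ≠ abar p (αs j) := by
    intro j hl
    by_cases hj : j = r
    · subst hj; exact hsr
    · by_cases hj2 : j = r + 1
      · subst hj2
        intro h
        have h1 := congrFun h z
        unfold abar at h1
        rw [αi, βi, Function.update_self] at h1
        omega
      · rw [αo j hj hj2, βo j hj hj2]; exact hsz j
  -- the image
  set M : SympV p t m → GaloisField p t := mono (αs r) (βs r) with hM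
  set Gi : SympV p t m → GaloisField p t := mono (αs (r + 1)) (βs (r + 1)) + e (r + 1) •
    mono (abar p (β (r + 1)))
      (Function.update (abar p (α (r + 1))) z (abar p (α (r + 1)) z + 1)) with hGi
  set G : Fin t → SympV p t m → GaloisField p t :=
    Function.update (Function.update F r M) (r + 1) Gi with hG
  have Gr : G r = M := by
    rw [hG, Function.update_of_ne hne.symm, Function.update_self]
  have Gi' : G (r + 1) = Gi := Function.update_self _ _ _
  have Go : ∀ j, j ≠ r → j ≠ r + 1 → G j = F j := fun j h1 h2 => by
    rw [hG, Function.update_of_ne h2, Function.update_of_ne h1]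
  have himg : Xop z (α r z * p ^ (r : ℕ))
      (Eop z (∑ j, ((α j z : ℤ) - β j z) * (p : ℤ) ^ (j : ℕ)) (tw F)) = tw G := by
    rw [hF, Eop_tw (NeZero.ne t) z _ α β e a1 a2, sub_self, if_pos (dvd_zero _)]
    rw [Xop_tw (NeZero.ne t) z r (α r z) (by have := a1 r z; omega) _ α β e a1 (fun j => rfl),
      Dm_zero z (abar p (β r)) _ _ (by unfold abar; omega), smul_zero, add_zero, Dm_top,
      show β r z + α r z = (α r z - 1) + p by omega, tw_extract, ← hF, ← αr, ← βr]
    funext v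
    have h3 := tw_update (Function.update F r M) (r + 1) Gi v
    have h1 := tw_update (Function.update F r M) (r + 1) (F (r + 1)) v
    have h2 : Function.update (Function.update F r M) (r + 1) (F (r + 1)) =
        Function.update F r M := by
      rw [← Function.update_of_ne hne M F, Function.update_eq_self]
    rw [h2] at h1
    rw [hG, h3, ← hM, h1, ← mul_assoc, ← mul_pow]
    congr 2
    simp only [hGi, hF, αi, βi, Pi.add_apply, Pi.smul_apply, smul_eq_mul, mono_upd_y, pow_one]
    ring
  have hei : e (r + 1) ≠ 0 → lamOfN p t d s (r + 1) = m * (p - 1) := by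
    intro h
    by_contra hn
    exact h (if_neg hn)
  refine ⟨tw F, α r z, fun j => (α j z : ℤ) - β j z, αs, βs, ⟨F, hFd, rfl⟩, a1 r z, ?_, ?_, ?_,
    hαs1, hβs1, hsum, hsz', ?_, ?_⟩
  · omega
  · intro h j hj
    by_cases hj2 : j = r
    · subst hj2
      change (α j z : ℤ) - β j z = 0
      omega
    · have := ao j hj2 hj
      change (α j z : ℤ) - β j z = 0
      omega
  · change (α (r + 1) z : ℤ) - β (r + 1) z = 1 ∨ ((α (r + 1) z : ℤ) - β (r + 1) z = 0 ∧ _)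
    omega
  · rw [himg]
    refine absorb hodd (dec_le s _) hs' {r, r + 1} ?_ G ?_ ?_
    · intro l hl
      simp only [Finset.mem_insert, Finset.mem_singleton] at hl
      rcases hl with rfl | rfl
      · right; rw [dec_self]; omega
      · left; rw [dec_self]; omega
    · intro l hl
      simp only [Finset.mem_insert, Finset.mem_singleton] at hl
      rcases hl with rfl | rfl
      · rw [Gr]
        exact Submodule.subset_span ⟨_, _, hαs1 l, hβs1 l, hsum l, rfl⟩
      · rw [Gi', hGi]
        refine Submodule.add_mem _
          (Submodule.subset_span ⟨_, _, hαs1 _, hβs1 _, hsum _, rfl⟩) ?_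
        by_cases hz : e (r + 1) = 0
        · rw [hz, zero_smul]; exact Submodule.zero_mem _
        · have hl := hei hz
          have hz1 : abar p (α (r + 1)) z = 0 := by unfold abar; omega
          refine Submodule.smul_mem _ _ (Submodule.subset_span ⟨_, _, abar_le p _,
            upd_le (abar_le p _) z (by omega), ?_, rfl⟩)
          have c1 := abar_sum p _ (a1 (r + 1))
          have c2 := abar_sum p _ (a2 (r + 1))
          have c3 := sum_update_z z (abar p (α (r + 1))) (abar p (α (r + 1)) z + 1)
          have c4 := a3 (r + 1)
          omega
    · intro l hl
      simp only [Finset.mem_insert, Finset.mem_singleton, not_or] at hl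
      rw [Go l hl.1 hl.2, hlo l hl.1 hl.2]
      exact hFd l
  · intro eps' hle
    rw [himg]
    have key : ∀ j, ∃ (A B : Bool → Fin m → ℕ) (E : Bool → GaloisField p t),
        (∀ b i, A b i ≤ p - 1) ∧ (∀ b i, B b i ≤ p - 1) ∧
        G j = ∑ b, E b • mono (A b) (B b) ∧
        loc (pe (cst p t (lamOfN p t d (dec s (r + 1)) j) (j ∈ eps') (αs j) (βs j)))
          (pa p (αs j) (βs j)) (pb p (αs j) (βs j)) E A B ≠ 0 := by
      intro j
      by_cases hj : j = r
      · subst hj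
        refine ⟨pa p (αs j) (βs j), pb p (αs j) (βs j), pe 0, pa_le (hαs1 j), pb_le (hβs1 j), ?_, ?_⟩
        · rw [mono_pair, Gr, zero_smul, add_zero]
        · rw [loc_self (Or.inr hsr)]; simp
      · by_cases hj2 : j = r + 1
        · subst hj2
          by_cases hz : e (r + 1) = 0
          · refine ⟨pa p (αs (r + 1)) (βs (r + 1)), pb p (αs (r + 1)) (βs (r + 1)), pe 0,
              pa_le (hαs1 (r + 1)), pb_le (hβs1 (r + 1)), ?_, ?_⟩
            · rw [mono_pair, Gi', hGi, hz, zero_smul, zero_smul]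
            · rw [loc_self]
              · simp
              · by_cases hl : lamOfN p t d (dec s (r + 1)) (r + 1) = m * (p - 1)
                · exact Or.inr (hsz' _ hl)
                · exact Or.inl ⟨if_neg hl, rfl⟩
          · have hl := hei hz
            have hl' : lamOfN p t d (dec s (r + 1)) (r + 1) ≠ m * (p - 1) := by omega
            have hz1 : abar p (α (r + 1)) z = 0 := by unfold abar; omega
            refine ⟨fun b => bif b then abar p (β (r + 1)) else αs (r + 1),
              fun b => bif b then
                Function.update (abar p (α (r + 1))) z (abar p (α (r + 1)) z + 1)
                else βs (r + 1), pe (e (r + 1)), ?_, ?_, ?_, ?_⟩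
            · intro b
              cases b
              · exact hαs1 _
              · exact abar_le p _
            · intro b
              cases b
              · exact hβs1 _
              · exact upd_le (abar_le p _) z (by omega)
            · rw [Gi', hGi, Fintype.sum_bool]
              simp only [pe, cond_true, cond_false, one_smul]
              exact add_comm _ _
            · have hc0 : cst p t (lamOfN p t d (dec s (r + 1)) (r + 1)) (r + 1 ∈ eps')
                  (αs (r + 1)) (βs (r + 1)) = 0 := if_neg hl'
              have hn : αs (r + 1) ≠ abar p (β (r + 1)) := by
                intro h
                have h1 := congrFun h z
                rw [αi] at h1
                unfold abar at h1
                omega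
              rw [hc0]
              unfold loc
              simp [Fintype.sum_bool, pe, pa, pb, hn]
        · refine ⟨pa p (αs j) (βs j), pb p (αs j) (βs j), pe (e j), pa_le (hαs1 j), pb_le (hβs1 j), ?_, ?_⟩
          · rw [mono_pair, Go j hj hj2, αo j hj hj2, βo j hj hj2]
          · rw [loc_self (Or.inr (by rw [αo j hj hj2, βo j hj hj2]; exact hsz j)),
              αo j hj hj2, βo j hj hj2, hlo j hj hj2]
            by_cases hl : lamOfN p t d s j = m * (p - 1)
            · have hiff : j ∈ eps ↔ j ∈ eps' := by
                have hZ : j ∈ Zset p t m d (dec s (r + 1)) s := by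
                  simp only [Zset, Finset.mem_filter, Finset.mem_univ, true_and]
                  refine ⟨dec_ne s hj2, dec_ne s (fun h => hj (add_right_cancel h)), ?_⟩
                  rw [← lamOfN_cast hs', hlo j hj hj2, hl, ← hcast]
                  push_cast; rfl
                have := Finset.ext_iff.1 hle.2 j
                simpa [hZ] using this
              have hk := kap_mul (t := t) hodd _ _ (a1 j) (a2 j)
              have h2 := two_ne (t := t) hodd
              have : cst p t (lamOfN p t d s j) (j ∈ eps') (α j) (β j) * e j = 1 := by
                simp only [cst, he, if_pos hl, hiff]
                by_cases hje : j ∈ eps'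
                · simp only [if_pos hje]; linear_combination hk
                · simp only [if_neg hje]; linear_combination hk
              rw [this, one_add_one_eq_two]
              exact h2
            · have : e j = 0 := if_neg hl
              rw [this]; simp
    choose A B E k1 k2 k3 k4 using key
    unfold Phi
    rw [(funext k3 : G = _), phi_tw (NeZero.ne t) _ _ _ _ _ _ (fun j => pa_le (hαs1 j))
      (fun j => pb_le (hβs1 j)) k1 k2]
    exact Finset.prod_ne_zero_iff.2 fun j _ => pow_ne_zero _ (k4 j)


/-- Lemma (non-splitting): let `(s,ε)` be non-minimal in `S[d]` (resp. `S` for `d = 0`),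
`(s',ε')` immediately below `(s,ε)`, and
`K = Y_<(s',ε')[d] + Σ_{(s'',ε'') immediately below (s,ε), ≠ (s',ε')} Y(s'',ε'')[d]`.
Then there is no `Sp(V)`-stable subspace `W ⊆ Y(s,ε)[d]` containing `K` with
`W + Y(s',ε')[d] = Y(s,ε)[d]` and `W ∩ (Y(s',ε')[d] + K) ⊆ K`; equivalently, the short
exact sequence `0 → (Y(s',ε')[d]+K)/K → Y(s,ε)[d]/K → Y(s,ε)[d]/Y_<(s,ε)[d] → 0`
does not split. -/
theorem nonsplit (p t m d : ℕ) [Fact p.Prime] [NeZero t]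
    (hodd : Odd p) (ht : 1 < t) (hm : 2 ≤ m) (hd : d ≤ p ^ t - 2)
    (s : Fin t → ℤ) (eps : Finset (Fin t))
    (hmem : memCase p t m d s eps)
    (hnotmin : ∃ (s₀ : Fin t → ℤ) (eps₀ : Finset (Fin t)),
      ltCase p t m d s₀ eps₀ s eps)
    (s' : Fin t → ℤ) (eps' : Finset (Fin t))
    (himm : ImmBelow p t m d s' eps' s eps) :
    ¬∃ W : Submodule (GaloisField p t) (SympV p t m → GaloisField p t),
      SpStable W ∧ W ≤ Ymod p t m d s eps ∧
      (Yltmod p t m d s' eps' ⊔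
        ⨆ (s'' : Fin t → ℤ) (eps'' : Finset (Fin t))
          (_ : ImmBelow p t m d s'' eps'' s eps ∧ ¬(s'' = s' ∧ eps'' = eps')),
          Ymod p t m d s'' eps'') ≤ W ∧
      W ⊔ Ymod p t m d s' eps' = Ymod p t m d s eps ∧
      W ⊓ (Ymod p t m d s' eps' ⊔
        (Yltmod p t m d s' eps' ⊔
          ⨆ (s'' : Fin t → ℤ) (eps'' : Finset (Fin t))
            (_ : ImmBelow p t m d s'' eps'' s eps ∧ ¬(s'' = s' ∧ eps'' = eps')),
            Ymod p t m d s'' eps'')) ≤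
        (Yltmod p t m d s' eps' ⊔
          ⨆ (s'' : Fin t → ℤ) (eps'' : Finset (Fin t))
            (_ : ImmBelow p t m d s'' eps'' s eps ∧ ¬(s'' = s' ∧ eps'' = eps')),
            Ymod p t m d s'' eps'') := by
  have hp3 : 3 ≤ p := by
    have h2 := (Fact.out : p.Prime).two_le
    rcases hodd with ⟨n, hn⟩
    omega
  obtain ⟨r, rfl⟩ := immBelow_dec hm ht hd hmem himm
  have hs := (memCase_iff ..).1 hmem
  have hs' := (memCase_iff ..).1 himm.1.1
  rintro ⟨W, hW, hWY, hKW, hsup, hinf⟩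
  obtain ⟨f, a, c, αs, βs, hf, ha, hcase, hc0, hci, h1, h2, h3, h4, himg, hphi⟩ :=
    upper hodd hp3 ht hm (⟨0, by omega⟩ : Fin m) r hs.1 hs.2 hs'.1
  set z : Fin m := ⟨0, by omega⟩
  set K := Yltmod p t m d (dec s (r + 1)) eps' ⊔
    ⨆ (s'' : Fin t → ℤ) (eps'' : Finset (Fin t))
      (_ : ImmBelow p t m d s'' eps'' s eps ∧ ¬(s'' = dec s (r + 1) ∧ eps'' = eps')),
      Ymod p t m d s'' eps'' with hK
  refine hphi eps' himm.1.2.1 ?_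
  have hKker : K ≤ LinearMap.ker (Phi p t m (lamOfN p t d (dec s (r + 1))) eps' αs βs) := by
    refine sup_le ?_ (iSup_le fun s2 => iSup_le fun eps2 => iSup_le fun hi => ?_)
    · refine Submodule.span_le.2 ?_
      rintro g ⟨s3, eps3, hm3, -, hne3, hg⟩
      exact Phi_vanish hodd hm3 himm.1.1 hne3 h1 h2 h3 h4 hg
    · refine Submodule.span_le.2 ?_
      rintro g ⟨s3, eps3, hm3, hle3, hg⟩
      by_cases hq : s3 = dec s (r + 1) ∧ eps3 = eps'
      · exfalso
        obtain ⟨rfl, rfl⟩ := hq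
        exact himm.2 ⟨s2, eps2, hi.1.1, hm3, hle3, fun h => hi.2 ⟨h.1.symm, h.2.symm⟩⟩
      · exact Phi_vanish hodd hm3 himm.1.1 hq h1 h2 h3 h4 hg
  refine hKker ?_
  have hex : Yex p t m d (dec s (r + 1)) s eps ≤ Ymod p t m d (dec s (r + 1)) eps' ⊔ K := by
    refine Submodule.span_le.2 ?_
    rintro g ⟨eps2, hm2, hle2, hg⟩
    by_cases hq : eps2 = eps'
    · subst hq
      exact Submodule.mem_sup_left
        (Submodule.subset_span ⟨_, _, hm2, ⟨fun _ => le_rfl, rfl⟩, hg⟩)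
    · refine Submodule.mem_sup_right (Submodule.mem_sup_right ?_)
      have hi := immBelow_of_dec hmem (r + 1) hm2 hle2
      refine Submodule.mem_iSup_of_mem (dec s (r + 1)) (Submodule.mem_iSup_of_mem eps2
        (Submodule.mem_iSup_of_mem ⟨hi, fun h => hq h.2⟩ ?_))
      exact Submodule.subset_span ⟨_, _, hm2, ⟨fun _ => le_rfl, rfl⟩, hg⟩
  set A : (SympV p t m → GaloisField p t) →ₗ[GaloisField p t]
      (SympV p t m → GaloisField p t) :=
    (Xop z (a * p ^ (r : ℕ))).comp (Eop z (∑ j, c j * (p : ℤ) ^ (j : ℕ))) with hA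
  change A f ∈ K
  have hAf : A f ∈ Ymod p t m d (dec s (r + 1)) eps' ⊔ K := hex himg
  have hAW : ∀ w ∈ W, A w ∈ W := fun w hw => Xop_stable z _ hW (Eop_stable z _ hW hw)
  have hsplit : Ymod p t m d (dec s (r + 1)) eps' ≤
      (Yltmod p t m d (dec s (r + 1)) eps').comap A ⊔ Yltmod p t m d (dec s (r + 1)) eps' := by
    refine Submodule.span_le.2 ?_
    rintro g ⟨s3, eps3, hm3, hle3, hg⟩
    by_cases hq : s3 = dec s (r + 1) ∧ eps3 = eps'
    · obtain ⟨rfl, rfl⟩ := hq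
      exact Submodule.mem_sup_left (lower hodd hp3 ht hd z hs'.1 r a ha hcase c hc0 hci hg)
    · exact Submodule.mem_sup_right (Submodule.subset_span ⟨_, _, hm3, hle3, hq, hg⟩)
  have hfY : f ∈ W ⊔ Ymod p t m d (dec s (r + 1)) eps' := by
    rw [hsup]
    exact Submodule.subset_span ⟨_, _, hmem, ⟨fun _ => le_rfl, rfl⟩, hf⟩
  obtain ⟨w, hw, y, hy, rfl⟩ := Submodule.mem_sup.1 hfY
  obtain ⟨y0, hy0, y1, hy1, rfl⟩ := Submodule.mem_sup.1 (hsplit hy)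
  have hy0K : A y0 ∈ K := Submodule.mem_sup_left hy0
  have hwW : A (w + y1) ∈ W :=
    hAW _ (W.add_mem hw (hKW (Submodule.mem_sup_left hy1)))
  have heq : A (w + (y0 + y1)) = A (w + y1) + A y0 := by
    simp only [map_add]; abel
  rw [heq] at hAf ⊢
  refine K.add_mem (hinf ⟨hwW, ?_⟩) hy0K
  have := Submodule.sub_mem _ hAf (Submodule.mem_sup_right hy0K)
  rwa [add_sub_cancel_right] at this

end
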